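/- arXiv:math/0109187 — 14 statements merged into one kernel-verified Lean document; each statement's English description precedes it below -/
import Mathlib

section
/- The Scorer function Hi, defined for z ∈ ℂ by Hi(z) = (1/π) ∫₀^∞ exp(z t − t³/3) dt, is an entire function, i.e. it is complex differentiable (analytic) at every point of ℂ. -/
open MeasureTheory Set

/-- The Scorer function `Hi`. -/
noncomputable def Hi (z : ℂ) : ℂ :=
  (1 / (Real.pi : ℂ)) * ∫ t in Ioi (0 : ℝ), Complex.exp (z * t - (t : ℂ) ^ 3 / 3)

lemma mul_sub_cube_div_three_le {m t : ℝ} (hm : 1 ≤ m) (ht : 0 ≤ t) :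
    m * t - t ^ 3 / 3 ≤ m ^ 3 := by
  have h : 0 ≤ (t - m) ^ 2 * (t + 2 * m) := by positivity
  have h' : 0 ≤ m * (m - 1) * t :=
    mul_nonneg (mul_nonneg (by linarith) (by linarith)) ht
  have h'' : 0 ≤ m ^ 3 := by positivity
  nlinarith

lemma norm_exp_mul_sub_cube_le {z : ℂ} {R t : ℝ} (hz : ‖z‖ ≤ R) (ht : 0 ≤ t) :
    ‖Complex.exp (z * t - (t : ℂ) ^ 3 / 3)‖ ≤ Real.exp ((R + 2) ^ 3) * Real.exp (-2 * t) := by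
  have hR : 0 ≤ R := (norm_nonneg z).trans hz
  have hre : (z * t - (t : ℂ) ^ 3 / 3).re = z.re * t - t ^ 3 / 3 := by
    rw [show z * t - (t : ℂ) ^ 3 / 3 = z * t - ((t ^ 3 / 3 : ℝ) : ℂ) by push_cast; rfl,
      Complex.sub_re, Complex.re_mul_ofReal, Complex.ofReal_re]
  rw [Complex.norm_exp, hre, ← Real.exp_add, Real.exp_le_exp]
  have h₁ := mul_le_mul_of_nonneg_right ((Complex.re_le_norm z).trans hz) ht
  have h₂ := mul_sub_cube_div_three_le (m := R + 2) (by linarith) ht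
  linarith

lemma norm_mul_exp_mul_sub_cube_le {z : ℂ} {R t : ℝ} (hz : ‖z‖ ≤ R) (ht : 0 ≤ t) :
    ‖Complex.exp (z * t - (t : ℂ) ^ 3 / 3) * t‖ ≤
      Real.exp ((R + 2) ^ 3) * Real.exp (-1 * t) := by
  rw [norm_mul, Complex.norm_real, Real.norm_of_nonneg ht]
  calc _ ≤ Real.exp ((R + 2) ^ 3) * Real.exp (-2 * t) * Real.exp t := by
        gcongr
        · exact norm_exp_mul_sub_cube_le hz ht
        · linarith [Real.add_one_le_exp t]
    _ = _ := by
        rw [mul_assoc, ← Real.exp_add]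
        ring_nf

lemma integrableOn_exp_mul_sub_cube (z : ℂ) :
    IntegrableOn (fun t : ℝ ↦ Complex.exp (z * t - (t : ℂ) ^ 3 / 3)) (Ioi 0) := by
  refine Integrable.mono'
    ((integrableOn_exp_mul_Ioi (by norm_num : (-2 : ℝ) < 0) 0).const_mul
      (Real.exp ((‖z‖ + 2) ^ 3)))
    (Continuous.aestronglyMeasurable (by fun_prop)) ?_
  filter_upwards [ae_restrict_mem measurableSet_Ioi] with t ht
  exact norm_exp_mul_sub_cube_le le_rfl (le_of_lt ht)

lemma hasDerivAt_integral_exp_mul_sub_cube (z : ℂ) :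
    HasDerivAt (fun w : ℂ ↦ ∫ t in Ioi (0 : ℝ), Complex.exp (w * t - (t : ℂ) ^ 3 / 3))
      (∫ t in Ioi (0 : ℝ), Complex.exp (z * t - (t : ℂ) ^ 3 / 3) * t) z := by
  refine (hasDerivAt_integral_of_dominated_loc_of_deriv_le
    (μ := volume.restrict (Ioi 0))
    (F := fun w (t : ℝ) ↦ Complex.exp (w * t - (t : ℂ) ^ 3 / 3))
    (F' := fun w (t : ℝ) ↦ Complex.exp (w * t - (t : ℂ) ^ 3 / 3) * t)
    (bound := fun t ↦ Real.exp ((‖z‖ + 1 + 2) ^ 3) * Real.exp (-1 * t))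
    (Metric.ball_mem_nhds z one_pos)
    (.of_forall fun w ↦ Continuous.aestronglyMeasurable (by fun_prop))
    (integrableOn_exp_mul_sub_cube z)
    (Continuous.aestronglyMeasurable (by fun_prop)) ?_
    ((integrableOn_exp_mul_Ioi (by norm_num : (-1 : ℝ) < 0) 0).const_mul _) ?_).2
  · filter_upwards [ae_restrict_mem measurableSet_Ioi] with t ht w hw
    refine norm_mul_exp_mul_sub_cube_le ?_ (le_of_lt ht)
    have h := norm_le_norm_add_norm_sub z w
    rw [Metric.mem_ball, dist_eq_norm, norm_sub_rev] at hw
    linarith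
  · refine .of_forall fun t w _ ↦ ?_
    simpa using (((hasDerivAt_id w).mul_const (t : ℂ)).sub_const ((t : ℂ) ^ 3 / 3)).cexp

theorem scorer_Hi_entire : Differentiable ℂ Hi := fun z ↦
  ((hasDerivAt_integral_exp_mul_sub_cube z).const_mul (1 / (Real.pi : ℂ))).differentiableAt
end

section
/- The Scorer function Hi satisfies the inhomogeneous Airy differential equation: for every z ∈ ℂ, Hi is twice complex differentiable at z and Hi''(z) − z · Hi(z) = 1/π. -/
open MeasureTheory Set

theorem exists_mul_sub_cube_le (A : ℝ) :
    ∃ C : ℝ, ∀ t : ℝ, 0 ≤ t → A * t - t ^ 3 / 3 ≤ C - t := by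
  set S := |A| + 2 with hS
  have hS2 : 2 ≤ S := by linarith [abs_nonneg A]
  have hA : A + 1 ≤ S := by linarith [le_abs_self A]
  refine ⟨3 * S ^ 2, fun t ht => ?_⟩
  have h1 : (A + 1) * t ≤ S * t := mul_le_mul_of_nonneg_right hA ht
  rcases le_total t (3 * S) with h | h
  · have : 0 ≤ t ^ 3 := by positivity
    nlinarith
  · have h2 : S ≤ t ^ 2 := by nlinarith
    have h3 : 3 * S ≤ t ^ 2 := by nlinarith
    have h4 : 3 * S * t ≤ t ^ 2 * t := mul_le_mul_of_nonneg_right h3 ht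
    nlinarith [sq_nonneg S]

theorem norm_cexp_mul_sub_cube_le {z : ℂ} {R t : ℝ} (hz : ‖z‖ ≤ R) (ht : 0 ≤ t) :
    ‖Complex.exp (z * t - (t : ℂ) ^ 3 / 3)‖ ≤ Real.exp (R * t - t ^ 3 / 3) := by
  have h : (z * t - (t : ℂ) ^ 3 / 3).re = z.re * t - t ^ 3 / 3 := by
    have : (t : ℂ) ^ 3 / 3 = ((t ^ 3 / 3 : ℝ) : ℂ) := by push_cast; rfl
    rw [this, Complex.sub_re, Complex.ofReal_re, Complex.re_mul_ofReal]
  rw [Complex.norm_exp, h]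
  gcongr
  exact (Complex.re_le_norm z).trans hz

theorem integrableOn_pow_mul_exp_mul_sub_cube (n : ℕ) (R : ℝ) :
    IntegrableOn (fun t : ℝ => t ^ n * Real.exp (R * t - t ^ 3 / 3)) (Ioi 0) := by
  obtain ⟨C, hC⟩ := exists_mul_sub_cube_le R
  have h := (Real.GammaIntegral_convergent (s := n + 1) (by positivity)).const_mul (Real.exp C)
  refine h.mono' (by fun_prop) ?_
  filter_upwards [ae_restrict_mem measurableSet_Ioi] with t ht
  have ht0 : (0 : ℝ) ≤ t := le_of_lt ht
  rw [Real.norm_of_nonneg (by positivity), add_sub_cancel_right, Real.rpow_natCast, ← mul_assoc,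
    ← Real.exp_add, mul_comm]
  gcongr
  linarith [hC t ht0]

theorem hasDerivAt_integral_pow_mul_cexp (n : ℕ) (z : ℂ) :
    HasDerivAt (fun w : ℂ => ∫ t in Ioi (0 : ℝ), (t : ℂ) ^ n * Complex.exp (w * t - (t : ℂ) ^ 3 / 3))
      (∫ t in Ioi (0 : ℝ), (t : ℂ) ^ (n + 1) * Complex.exp (z * t - (t : ℂ) ^ 3 / 3)) z := by
  have hbound : ∀ (m : ℕ), ∀ t ∈ Ioi (0 : ℝ), ∀ w ∈ Metric.ball z 1,
      ‖(t : ℂ) ^ m * Complex.exp (w * t - (t : ℂ) ^ 3 / 3)‖ ≤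
        t ^ m * Real.exp ((‖z‖ + 1) * t - t ^ 3 / 3) := by
    intro m t ht w hw
    have ht0 : (0 : ℝ) ≤ t := le_of_lt ht
    rw [norm_mul, norm_pow, Complex.norm_real, Real.norm_of_nonneg ht0]
    gcongr
    refine norm_cexp_mul_sub_cube_le ?_ ht0
    have := norm_sub_norm_le w z
    rw [Metric.mem_ball, dist_eq_norm] at hw
    linarith
  refine (hasDerivAt_integral_of_dominated_loc_of_deriv_le
    (F' := fun w (t : ℝ) => (t : ℂ) ^ (n + 1) * Complex.exp (w * t - (t : ℂ) ^ 3 / 3))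
    (Metric.ball_mem_nhds z one_pos) (Filter.Eventually.of_forall fun w => by fun_prop) ?_
    (by fun_prop) ?_ (integrableOn_pow_mul_exp_mul_sub_cube (n + 1) (‖z‖ + 1)) ?_).2
  · refine (integrableOn_pow_mul_exp_mul_sub_cube n (‖z‖ + 1)).mono' (by fun_prop) ?_
    filter_upwards [ae_restrict_mem measurableSet_Ioi] with t ht
    exact hbound n t ht z (Metric.mem_ball_self one_pos)
  · filter_upwards [ae_restrict_mem measurableSet_Ioi] with t ht
    exact hbound (n + 1) t ht
  · refine Filter.Eventually.of_forall fun t w _ => ?_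
    refine (((((hasDerivAt_id w).mul_const (t : ℂ)).sub_const ((t : ℂ) ^ 3 / 3)).cexp).const_mul
      ((t : ℂ) ^ n)).congr_deriv ?_
    simp only [id_eq]
    ring

theorem integrableOn_pow_mul_cexp (n : ℕ) (z : ℂ) :
    IntegrableOn (fun t : ℝ => (t : ℂ) ^ n * Complex.exp (z * t - (t : ℂ) ^ 3 / 3)) (Ioi 0) := by
  refine (integrableOn_pow_mul_exp_mul_sub_cube n ‖z‖).mono' (by fun_prop) ?_
  filter_upwards [ae_restrict_mem measurableSet_Ioi] with t ht
  have ht0 : (0 : ℝ) ≤ t := le_of_lt ht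
  rw [norm_mul, norm_pow, Complex.norm_real, Real.norm_of_nonneg ht0]
  gcongr
  exact norm_cexp_mul_sub_cube_le le_rfl ht0

theorem tendsto_cexp_mul_sub_cube (z : ℂ) :
    Filter.Tendsto (fun t : ℝ => Complex.exp (z * t - (t : ℂ) ^ 3 / 3)) Filter.atTop (nhds 0) := by
  obtain ⟨C, hC⟩ := exists_mul_sub_cube_le ‖z‖
  refine squeeze_zero_norm' (a := fun t => Real.exp (C - t)) ?_ ?_
  · filter_upwards [Filter.eventually_ge_atTop 0] with t ht
    exact (norm_cexp_mul_sub_cube_le le_rfl ht).trans (Real.exp_le_exp.2 (hC t ht))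
  · exact Real.tendsto_exp_atBot.comp
      (Filter.tendsto_atBot_add_const_left _ C Filter.tendsto_neg_atTop_atBot)

theorem integral_sub_sq_mul_cexp (z : ℂ) :
    ∫ t in Ioi (0 : ℝ), ((t : ℂ) ^ 2 * Complex.exp (z * t - (t : ℂ) ^ 3 / 3) -
      z * Complex.exp (z * t - (t : ℂ) ^ 3 / 3)) = 1 := by
  have hint := (integrableOn_pow_mul_cexp 2 z).sub
    ((integrableOn_pow_mul_cexp 0 z).const_mul z)
  simp only [pow_zero, one_mul] at hint
  rw [integral_Ioi_of_hasDerivAt_of_tendsto' (m := 0)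
    (f := fun t : ℝ => -Complex.exp (z * t - (t : ℂ) ^ 3 / 3))
    (f' := fun t : ℝ => (t : ℂ) ^ 2 * Complex.exp (z * t - (t : ℂ) ^ 3 / 3) -
      z * Complex.exp (z * t - (t : ℂ) ^ 3 / 3)) ?_ hint ?_]
  · simp
  · intro t _
    have ht : HasDerivAt (fun s : ℝ => (s : ℂ)) 1 t := Complex.ofRealCLM.hasDerivAt
    refine (((ht.const_mul z).sub ((ht.pow 3).div_const 3)).cexp).neg.congr_deriv ?_
    simp only [Pi.sub_apply, Pi.pow_apply]
    push_cast
    ring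
  · simpa using (tendsto_cexp_mul_sub_cube z).neg

theorem scorer_Hi_inhomogeneous_airy (z : ℂ) :
    DifferentiableAt ℂ Hi z ∧ DifferentiableAt ℂ (deriv Hi) z ∧
      deriv (deriv Hi) z - z * Hi z = 1 / (Real.pi : ℂ) := by
  have h1 : ∀ w, HasDerivAt Hi ((1 / (Real.pi : ℂ)) * ∫ t in Ioi (0 : ℝ),
      (t : ℂ) ^ 1 * Complex.exp (w * t - (t : ℂ) ^ 3 / 3)) w := by
    intro w
    have h := (hasDerivAt_integral_pow_mul_cexp 0 w).const_mul (1 / (Real.pi : ℂ))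
    simp only [pow_zero, one_mul, zero_add] at h
    exact h
  have h2 : HasDerivAt (deriv Hi) ((1 / (Real.pi : ℂ)) * ∫ t in Ioi (0 : ℝ),
      (t : ℂ) ^ 2 * Complex.exp (z * t - (t : ℂ) ^ 3 / 3)) z := by
    rw [funext fun w => (h1 w).deriv]
    exact (hasDerivAt_integral_pow_mul_cexp 1 z).const_mul (1 / (Real.pi : ℂ))
  refine ⟨(h1 z).differentiableAt, h2.differentiableAt, ?_⟩
  have hint := (integrableOn_pow_mul_cexp 0 z).const_mul z
  simp only [pow_zero, one_mul] at hint
  have key := integral_sub_sq_mul_cexp z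
  rw [integral_sub (integrableOn_pow_mul_cexp 2 z) hint, integral_const_mul] at key
  rw [h2.deriv, Hi]
  linear_combination (1 / (Real.pi : ℂ)) * key
end

section
/- For every real number x, the improper integral ∫₀^∞ sin(x t + t³/3) dt converges, i.e. the limit lim_{R→∞} ∫₀^R sin(x t + t³/3) dt exists; hence the Scorer function Gi(x) = (1/π) lim_{R→∞} ∫₀^R sin(x t + t³/3) dt is well defined for every x ∈ ℝ. -/
open Filter

/-- **Dirichlet's test** for improper integrals: if `u` decreases to `0` on `[a, ∞)` and `v` is
bounded there, then `∫ t in a..R, u t * v' t` converges as `R → ∞`. -/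
theorem exists_tendsto_intervalIntegral_mul_deriv_of_antitone {u u' v v' : ℝ → ℝ} {a C : ℝ}
    (hu : ∀ t ∈ Set.Ici a, HasDerivAt u (u' t) t) (hv : ∀ t ∈ Set.Ici a, HasDerivAt v (v' t) t)
    (hv' : ContinuousOn v' (Set.Ici a)) (hu'_nonpos : ∀ t ∈ Set.Ioi a, u' t ≤ 0)
    (hu_zero : Tendsto u atTop (nhds 0)) (hv_bdd : ∀ t ∈ Set.Ici a, ‖v t‖ ≤ C) :
    ∃ L : ℝ, Tendsto (fun R : ℝ => ∫ t in a..R, u t * v' t) atTop (nhds L) := by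
  have hu' : MeasureTheory.IntegrableOn u' (Set.Ioi a) :=
    MeasureTheory.integrableOn_Ioi_deriv_of_nonpos' hu hu'_nonpos hu_zero
  have hvc : ContinuousOn v (Set.Ici a) := fun t ht => (hv t ht).continuousAt.continuousWithinAt
  have hu'v : MeasureTheory.IntegrableOn (fun t => u' t * v t) (Set.Ioi a) := by
    refine MeasureTheory.Integrable.mul_bdd hu' (c := C) ?_ ?_
    · exact (hvc.mono Set.Ioi_subset_Ici_self).aestronglyMeasurable measurableSet_Ioi
    · exact (MeasureTheory.ae_restrict_mem measurableSet_Ioi).mono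
        fun t ht => hv_bdd t (Set.Ioi_subset_Ici_self ht)
  have huv : Tendsto (fun R => u R * v R) atTop (nhds 0) :=
    hu_zero.zero_mul_isBoundedUnder_le
      (isBoundedUnder_of_eventually_le ((eventually_ge_atTop a).mono hv_bdd))
  refine ⟨_, ((huv.sub_const (u a * v a)).sub
    (MeasureTheory.intervalIntegral_tendsto_integral_Ioi a hu'v tendsto_id)).congr' ?_⟩
  filter_upwards [eventually_ge_atTop a] with R hR
  have hsub : Set.uIcc a R ⊆ Set.Ici a := by
    rw [Set.uIcc_of_le hR]
    exact Set.Icc_subset_Ici_self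
  refine (intervalIntegral.integral_mul_deriv_eq_deriv_mul (fun t ht => hu t (hsub ht))
    (fun t ht => hv t (hsub ht)) ?_ (hv'.mono hsub).intervalIntegrable).symm
  exact (intervalIntegrable_iff_integrableOn_Ioc_of_le hR).2 (hu'.mono_set Set.Ioc_subset_Ioi_self)

theorem scorer_Gi_integral_converges (x : ℝ) :
    ∃ L : ℝ, Tendsto (fun R : ℝ => ∫ t in (0 : ℝ)..R, Real.sin (x * t + t ^ 3 / 3))
      atTop (nhds L) := by
  have hpos : ∀ t ∈ Set.Ici (|x| + 1), 0 < x + t ^ 2 := fun t ht => by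
    have ht' : |x| + 1 ≤ t := ht
    nlinarith [neg_abs_le x, abs_nonneg x]
  have hphase : ∀ t : ℝ, HasDerivAt (fun t : ℝ => x * t + t ^ 3 / 3) (x + t ^ 2) t := fun t => by
    refine (((hasDerivAt_id t).const_mul x).add ((hasDerivAt_pow 3 t).div_const 3)).congr_deriv ?_
    norm_num
  have hcont : Continuous fun t : ℝ => Real.sin (x * t + t ^ 3 / 3) := by fun_prop
  obtain ⟨L, hL⟩ := exists_tendsto_intervalIntegral_mul_deriv_of_antitone
    (u := fun t => (x + t ^ 2)⁻¹) (u' := fun t => -(2 * t) / (x + t ^ 2) ^ 2)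
    (v := fun t => -Real.cos (x * t + t ^ 3 / 3))
    (v' := fun t => Real.sin (x * t + t ^ 3 / 3) * (x + t ^ 2)) (a := |x| + 1) (C := 1)
    (fun t ht => by
      refine HasDerivAt.fun_inv ?_ (hpos t ht).ne'
      simpa using (hasDerivAt_pow 2 t).const_add x)
    (fun t _ => (hphase t).cos.neg.congr_deriv (by ring))
    (by fun_prop)
    (fun t ht => by
      have ht' : |x| + 1 < t := ht
      have : 0 ≤ t := by linarith [abs_nonneg x]
      exact div_nonpos_of_nonpos_of_nonneg (by linarith) (sq_nonneg _))
    (tendsto_atTop_add_const_left _ x (tendsto_pow_atTop two_ne_zero)).inv_tendsto_atTop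
    (fun t _ => by simpa using Real.abs_cos_le_one _)
  refine ⟨_, (hL.const_add (∫ t in (0 : ℝ)..(|x| + 1), Real.sin (x * t + t ^ 3 / 3))).congr' ?_⟩
  filter_upwards [eventually_ge_atTop (|x| + 1)] with R hR
  rw [← intervalIntegral.integral_add_adjacent_intervals (hcont.intervalIntegrable 0 (|x| + 1))
    (hcont.intervalIntegrable (|x| + 1) R)]
  congr 1
  refine intervalIntegral.integral_congr fun t ht => ?_
  rw [Set.uIcc_of_le hR] at ht
  have := (hpos t ht.1).ne'
  field_simp
end

section
/- The Scorer function Gi satisfies the inhomogeneous Airy differential equation: Gi is twice differentiable on ℝ and for every x ∈ ℝ, Gi''(x) − x · Gi(x) = −1/π. -/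
open Filter

open MeasureTheory Set intervalIntegral in
/-- Away from stationary points of the phase, the truncated Scorer integral is uniformly bounded. -/
theorem abs_integral_sin_phase_le {s a b : ℝ} (ha : 0 ≤ a) (hab : a ≤ b) (hs : 1 ≤ s + a ^ 2) :
    |∫ t in a..b, Real.sin (s * t + t ^ 3 / 3)| ≤ 3 := by
  have hpos : ∀ t ∈ Icc a b, 1 ≤ s + t ^ 2 := fun t ht => by
    nlinarith [ht.1]
  have hphase : ∀ t, HasDerivAt (fun t : ℝ => s * t + t ^ 3 / 3) (s + t ^ 2) t := fun t => by
    refine HasDerivAt.congr_deriv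
      (((hasDerivAt_id t).const_mul s).add (((hasDerivAt_id t).pow 3).div_const 3)) ?_
    simp
  have hden : ∀ t, HasDerivAt (fun t : ℝ => s + t ^ 2) (2 * t) t := fun t => by
    refine HasDerivAt.congr_deriv
      (((hasDerivAt_id t).pow 2).const_add s) ?_
    simp
  have hprim : ∀ t, HasDerivAt (fun u => ∫ t in a..u, Real.sin (s * t + t ^ 3 / 3))
      (Real.sin (s * t + t ^ 3 / 3)) t := fun t =>
    (Continuous.integral_hasStrictDerivAt (by fun_prop) a t).hasDerivAt
  set H : ℝ → ℝ := fun u => (∫ t in a..u, Real.sin (s * t + t ^ 3 / 3))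
    + Real.cos (s * u + u ^ 3 / 3) / (s + u ^ 2) - Real.cos (s * a + a ^ 3 / 3) / (s + a ^ 2) with hH
  have hHd : ∀ t ∈ Icc a b, HasDerivAt H
      (-(Real.cos (s * t + t ^ 3 / 3) * (2 * t / (s + t ^ 2) ^ 2))) t := fun t ht => by
    have h0 : s + t ^ 2 ≠ 0 := by linarith [hpos t ht]
    refine HasDerivAt.congr_deriv
      (((hprim t).add ((hphase t).cos.div (hden t) h0)).sub_const
      (Real.cos (s * a + a ^ 3 / 3) / (s + a ^ 2))) ?_
    field_simp
    ring
  have hBd : ∀ t ∈ Icc a b, HasDerivAt (fun u : ℝ => 1 - (s + u ^ 2)⁻¹)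
      (2 * t / (s + t ^ 2) ^ 2) t := fun t ht => by
    have h0 : s + t ^ 2 ≠ 0 := by linarith [hpos t ht]
    refine HasDerivAt.congr_deriv
      (((hden t).inv h0).const_sub 1) ?_
    ring
  have hinv : (s + a ^ 2)⁻¹ ≤ 1 := inv_le_one_of_one_le₀ hs
  have key : ‖H b‖ ≤ 1 - (s + b ^ 2)⁻¹ := by
    refine image_norm_le_of_norm_deriv_right_le_deriv_boundary' (a := a) (b := b)
      (fun t ht => (hHd t ht).continuousAt.continuousWithinAt)
      (fun t ht => (hHd t (Ico_subset_Icc_self ht)).hasDerivWithinAt) ?_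
      (fun t ht => (hBd t ht).continuousAt.continuousWithinAt)
      (fun t ht => (hBd t (Ico_subset_Icc_self ht)).hasDerivWithinAt) ?_ (right_mem_Icc.2 hab)
    · simpa [hH] using hinv
    · intro t ht
      have ht0 : 0 ≤ t := ha.trans ht.1
      rw [norm_neg, norm_mul, Real.norm_of_nonneg (by positivity : 0 ≤ 2 * t / (s + t ^ 2) ^ 2)]
      exact mul_le_of_le_one_left (by positivity) (Real.abs_cos_le_one _)
  have hcos : ∀ t ∈ Icc a b, |Real.cos (s * t + t ^ 3 / 3) / (s + t ^ 2)| ≤ 1 := fun t ht => by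
    have h1 := hpos t ht
    rw [abs_div, abs_of_pos (by linarith : 0 < s + t ^ 2)]
    exact div_le_one_of_le₀ ((Real.abs_cos_le_one _).trans h1) (by linarith)
  have hb : 0 ≤ (s + b ^ 2)⁻¹ := inv_nonneg.2 (by linarith [hpos b (right_mem_Icc.2 hab)])
  have hHb : |H b| ≤ 1 := by
    rw [Real.norm_eq_abs] at key
    linarith
  have hca := abs_le.1 (hcos a (left_mem_Icc.2 hab))
  have hcb := abs_le.1 (hcos b (right_mem_Icc.2 hab))
  simp only [hH] at hHb
  rw [abs_le] at hHb ⊢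
  constructor <;> linarith [hHb.1, hHb.2, hca.1, hca.2, hcb.1, hcb.2]

/-- The truncated Scorer integrals are locally bounded, uniformly in the truncation. -/
theorem abs_scorer_truncation_le {K s R : ℝ} (hs : |s| ≤ K) (hR : 0 ≤ R) :
    |∫ t in (0 : ℝ)..R, Real.sin (s * t + t ^ 3 / 3)| ≤ K + 4 := by
  have hK : 0 ≤ K := (abs_nonneg s).trans hs
  have htriv : ∀ r, 0 ≤ r → |∫ t in (0 : ℝ)..r, Real.sin (s * t + t ^ 3 / 3)| ≤ r := fun r hr => by
    simpa [abs_of_nonneg hr] using intervalIntegral.norm_integral_le_of_norm_le_const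
      (a := 0) (b := r) (C := 1) (f := fun t => Real.sin (s * t + t ^ 3 / 3))
      fun t _ => Real.abs_sin_le_one _
  rcases le_total R (K + 1) with h | h
  · linarith [htriv R hR]
  · have hint : ∀ a b, IntervalIntegrable (fun t : ℝ => Real.sin (s * t + t ^ 3 / 3))
        MeasureTheory.volume a b := fun a b => Continuous.intervalIntegrable (by fun_prop) a b
    rw [← intervalIntegral.integral_add_adjacent_intervals (hint 0 (K + 1)) (hint (K + 1) R)]
    have h1 := htriv (K + 1) (by linarith)
    have h2 := abs_integral_sin_phase_le (s := s) (by linarith : 0 ≤ K + 1) h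
      (by nlinarith [(abs_le.1 hs).1])
    exact (abs_add_le _ _).trans (by linarith)

/-- Second order Taylor formula for `x ↦ sin (x * t + b)` with integral remainder. -/
theorem sin_mul_add_eq_taylor (x t b : ℝ) :
    Real.sin (x * t + b) = Real.sin b + x * (t * Real.cos b)
      - ∫ s in (0 : ℝ)..x, (x - s) * (t ^ 2 * Real.sin (s * t + b)) := by
  have hd : ∀ s ∈ Set.uIcc 0 x, HasDerivAt
      (fun s => -((x - s) * (t * Real.cos (s * t + b))) - Real.sin (s * t + b))
      ((x - s) * (t ^ 2 * Real.sin (s * t + b))) s := fun s _ => by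
    have hp : HasDerivAt (fun s : ℝ => s * t + b) t s := by
      simpa using ((hasDerivAt_id s).mul_const t).add_const b
    refine HasDerivAt.congr_deriv
      (((((hasDerivAt_id s).const_sub x).mul (hp.cos.const_mul t)).neg).sub hp.sin) ?_
    simp only [id]
    ring
  rw [intervalIntegral.integral_eq_sub_of_hasDerivAt hd
    (Continuous.intervalIntegrable (by fun_prop) _ _)]
  simp
  ring

/-- The twice integrated form of the differential equation satisfied by a truncated Scorer
integral. -/
theorem scorer_truncation_eq (R x : ℝ) :
    ∫ t in (0 : ℝ)..R, Real.sin (x * t + t ^ 3 / 3)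
      = (∫ t in (0 : ℝ)..R, Real.sin (0 * t + t ^ 3 / 3))
        + x * (∫ t in (0 : ℝ)..R, t * Real.cos (t ^ 3 / 3))
        + (∫ s in (0 : ℝ)..x, (x - s) * Real.cos (s * R + R ^ 3 / 3))
        + ∫ s in (0 : ℝ)..x,
            (x - s) * (s * (∫ t in (0 : ℝ)..R, Real.sin (s * t + t ^ 3 / 3)) - 1) := by
  have hinner : ∀ s : ℝ, ∫ t in (0 : ℝ)..R, (x - s) * (t ^ 2 * Real.sin (s * t + t ^ 3 / 3))
      = -((x - s) * Real.cos (s * R + R ^ 3 / 3)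
        + (x - s) * (s * (∫ t in (0 : ℝ)..R, Real.sin (s * t + t ^ 3 / 3)) - 1)) := fun s => by
    have hd : ∀ t ∈ Set.uIcc 0 R, HasDerivAt (fun t => -Real.cos (s * t + t ^ 3 / 3))
        (t ^ 2 * Real.sin (s * t + t ^ 3 / 3) + s * Real.sin (s * t + t ^ 3 / 3)) t :=
      fun t _ => by
        have hp : HasDerivAt (fun t : ℝ => s * t + t ^ 3 / 3) (s + t ^ 2) t := by
          refine HasDerivAt.congr_deriv
            (((hasDerivAt_id t).const_mul s).add (((hasDerivAt_id t).pow 3).div_const 3)) ?_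
          simp
        refine HasDerivAt.congr_deriv
          (hp.cos.neg) ?_
        ring
    have h := intervalIntegral.integral_eq_sub_of_hasDerivAt hd
      (Continuous.intervalIntegrable (by fun_prop) _ _)
    rw [intervalIntegral.integral_add (Continuous.intervalIntegrable (by fun_prop) _ _)
      (Continuous.intervalIntegrable (by fun_prop) _ _), intervalIntegral.integral_const_mul] at h
    rw [intervalIntegral.integral_const_mul, eq_sub_of_add_eq h]
    simp
    ring
  have hswap : ∫ t in (0 : ℝ)..R, ∫ s in (0 : ℝ)..x,
        (x - s) * (t ^ 2 * Real.sin (s * t + t ^ 3 / 3))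
      = ∫ s in (0 : ℝ)..x, ∫ t in (0 : ℝ)..R,
        (x - s) * (t ^ 2 * Real.sin (s * t + t ^ 3 / 3)) := by
    refine MeasureTheory.intervalIntegral_intervalIntegral_swap ?_
    have hc : Continuous (Function.uncurry fun t s : ℝ =>
        (x - s) * (t ^ 2 * Real.sin (s * t + t ^ 3 / 3))) := by fun_prop
    exact (hc.continuousOn.integrableOn_compact (isCompact_uIcc.prod isCompact_uIcc)).mono_set
      (Set.prod_mono Set.uIoc_subset_uIcc Set.uIoc_subset_uIcc)
  have htaylor : ∫ t in (0 : ℝ)..R, Real.sin (x * t + t ^ 3 / 3)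
      = ∫ t in (0 : ℝ)..R, (Real.sin (0 * t + t ^ 3 / 3) + x * (t * Real.cos (t ^ 3 / 3))
        - ∫ s in (0 : ℝ)..x, (x - s) * (t ^ 2 * Real.sin (s * t + t ^ 3 / 3))) := by
    simp_rw [sin_mul_add_eq_taylor x, zero_mul, zero_add]
  rw [htaylor, intervalIntegral.integral_sub (Continuous.intervalIntegrable (by fun_prop) _ _)
      (Continuous.intervalIntegrable (by fun_prop) _ _),
    intervalIntegral.integral_add (Continuous.intervalIntegrable (by fun_prop) _ _)
      (Continuous.intervalIntegrable (by fun_prop) _ _),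
    intervalIntegral.integral_const_mul, hswap]
  simp_rw [hinner]
  rw [intervalIntegral.integral_neg,
    intervalIntegral.integral_add (Continuous.intervalIntegrable (by fun_prop) _ _)
      (Continuous.intervalIntegrable (by fun_prop) _ _)]
  ring

theorem tendsto_integral_sub_mul_cos_phase (x : ℝ) :
    Tendsto (fun R : ℝ => ∫ s in (0 : ℝ)..x, (x - s) * Real.cos (s * R + R ^ 3 / 3))
      atTop (nhds 0) := by
  have heq : ∀ R : ℝ, 0 < R → ∫ s in (0 : ℝ)..x, (x - s) * Real.cos (s * R + R ^ 3 / 3)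
      = R⁻¹ * (R⁻¹ * (Real.cos (R ^ 3 / 3) - Real.cos (x * R + R ^ 3 / 3))
        - x * Real.sin (R ^ 3 / 3)) := fun R hR => by
    have hd : ∀ s ∈ Set.uIcc 0 x, HasDerivAt
        (fun s => R⁻¹ * ((x - s) * Real.sin (s * R + R ^ 3 / 3)
          - R⁻¹ * Real.cos (s * R + R ^ 3 / 3)))
        ((x - s) * Real.cos (s * R + R ^ 3 / 3)) s := fun s _ => by
      have hp : HasDerivAt (fun s : ℝ => s * R + R ^ 3 / 3) R s := by
        simpa using ((hasDerivAt_id s).mul_const R).add_const (R ^ 3 / 3)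
      refine HasDerivAt.congr_deriv
        (((((hasDerivAt_id s).const_sub x).mul hp.sin).sub
        (hp.cos.const_mul R⁻¹)).const_mul R⁻¹) ?_
      simp only [id]
      field_simp
      ring
    rw [intervalIntegral.integral_eq_sub_of_hasDerivAt hd
      (Continuous.intervalIntegrable (by fun_prop) _ _)]
    simp
    ring
  refine squeeze_zero_norm' (a := fun R : ℝ => R⁻¹ * (2 + |x|)) ?_ ?_
  · filter_upwards [eventually_ge_atTop 1] with R hR
    have hR0 : 0 < R := by linarith
    rw [heq R hR0, norm_mul, Real.norm_of_nonneg (inv_nonneg.2 hR0.le)]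
    refine mul_le_mul_of_nonneg_left ?_ (inv_nonneg.2 hR0.le)
    refine (norm_sub_le _ _).trans (add_le_add ?_ ?_)
    · rw [norm_mul, Real.norm_of_nonneg (inv_nonneg.2 hR0.le)]
      have h2 : ‖Real.cos (R ^ 3 / 3) - Real.cos (x * R + R ^ 3 / 3)‖ ≤ 2 :=
        (norm_sub_le _ _).trans (by
          linarith [Real.abs_cos_le_one (R ^ 3 / 3), Real.abs_cos_le_one (x * R + R ^ 3 / 3),
            Real.norm_eq_abs (Real.cos (R ^ 3 / 3)),
            Real.norm_eq_abs (Real.cos (x * R + R ^ 3 / 3))])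
      exact (mul_le_of_le_one_left (norm_nonneg _) (inv_le_one_of_one_le₀ hR)).trans h2
    · rw [norm_mul]
      exact mul_le_of_le_one_right (norm_nonneg _) (Real.abs_sin_le_one _)
  · simpa using tendsto_inv_atTop_zero.mul_const (2 + |x|)

theorem abs_le_max_abs_of_mem_uIoc {a b s : ℝ} (hs : s ∈ Set.uIoc a b) : |s| ≤ max |a| |b| := by
  rcases le_total a b with h | h
  · rw [Set.uIoc_of_le h] at hs
    exact abs_le_max_abs_abs hs.1.le hs.2
  · rw [Set.uIoc_of_ge h] at hs
    exact (abs_le_max_abs_abs hs.1.le hs.2).trans_eq (max_comm _ _)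

/-- A locally bounded measurable solution of the twice integrated form of the inhomogeneous Airy equation
is a classical solution. -/
theorem hasDerivAt_of_eq_integral {G : ℝ → ℝ} {c : ℝ} (hmeas : Measurable G)
    (hbdd : ∀ K s : ℝ, |s| ≤ K → |G s| ≤ K + 4)
    (hG : ∀ x, G x = G 0 + x * c + ∫ s in (0 : ℝ)..x, (x - s) * (s * G s - 1)) :
    (∀ x, HasDerivAt G (c + ∫ s in (0 : ℝ)..x, (s * G s - 1)) x) ∧
      ∀ x, HasDerivAt (fun x => c + ∫ s in (0 : ℝ)..x, (s * G s - 1)) (x * G x - 1) x := by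
  have hGi : ∀ a b, IntervalIntegrable G MeasureTheory.volume a b := fun a b => by
    refine (intervalIntegrable_const (c := max |a| |b| + 4)).mono_fun'
      hmeas.aestronglyMeasurable ?_
    refine (MeasureTheory.ae_restrict_iff' measurableSet_uIoc).2 (Eventually.of_forall fun s hs => ?_)
    exact hbdd _ s (abs_le_max_abs_of_mem_uIoc hs)
  have hg : ∀ a b, IntervalIntegrable (fun s => s * G s - 1) MeasureTheory.volume a b := fun a b =>
    ((hGi a b).continuousOn_mul continuousOn_id).sub intervalIntegrable_const
  have hsg : ∀ a b, IntervalIntegrable (fun s => s * (s * G s - 1)) MeasureTheory.volume a b :=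
    fun a b => (hg a b).continuousOn_mul continuousOn_id
  have hsplit : G = fun x => G 0 + x * c + (x * (∫ s in (0 : ℝ)..x, (s * G s - 1))
      - ∫ s in (0 : ℝ)..x, s * (s * G s - 1)) := by
    funext x
    rw [hG x, ← intervalIntegral.integral_const_mul,
      ← intervalIntegral.integral_sub ((hg 0 x).const_mul x) (hsg 0 x)]
    simp only [sub_mul]
  have hcont : Continuous G := by
    have h1 := intervalIntegral.continuous_primitive hg 0
    have h2 := intervalIntegral.continuous_primitive hsg 0
    rw [hsplit]
    exact (continuous_const.add (continuous_id.mul continuous_const)).add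
      ((continuous_id.mul h1).sub h2)
  have hd : ∀ x, HasDerivAt (fun x => ∫ s in (0 : ℝ)..x, (s * G s - 1)) (x * G x - 1) x :=
    fun x => (Continuous.integral_hasStrictDerivAt (by fun_prop) 0 x).hasDerivAt
  have hsd : ∀ x, HasDerivAt (fun x => ∫ s in (0 : ℝ)..x, s * (s * G s - 1))
      (x * (x * G x - 1)) x :=
    fun x => (Continuous.integral_hasStrictDerivAt
      (f := fun s => s * (s * G s - 1)) (by fun_prop) 0 x).hasDerivAt
  refine ⟨fun x => ?_, fun x => (hd x).const_add c⟩
  have h := (((hasDerivAt_id x).mul_const c).const_add (G 0)).add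
    (((hasDerivAt_id x).mul (hd x)).sub (hsd x))
  refine (h.congr_deriv ?_).congr_of_eventuallyEq (Eventually.of_forall fun y => ?_)
  · simp only [id]
    ring
  · exact congrFun hsplit y

theorem scorer_Gi_inhomogeneous_airy (Gi : ℝ → ℝ)
    (hGi : ∀ x : ℝ, Tendsto (fun R : ℝ => ∫ t in (0 : ℝ)..R, Real.sin (x * t + t ^ 3 / 3))
      atTop (nhds (Real.pi * Gi x))) :
    ∀ x : ℝ, DifferentiableAt ℝ Gi x ∧ DifferentiableAt ℝ (deriv Gi) x ∧
      deriv (deriv Gi) x - x * Gi x = -(1 / Real.pi) := by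
  set G : ℝ → ℝ := fun x => Real.pi * Gi x with hGdef
  have hmeas : Measurable G := by
    refine measurable_of_tendsto_metrizable' (atTop : Filter ℝ)
      (f := fun R x => ∫ t in (0 : ℝ)..R, Real.sin (x * t + t ^ 3 / 3))
      (fun R => Continuous.measurable (by fun_prop)) (tendsto_pi_nhds.2 hGi)
  have hbdd : ∀ K s : ℝ, |s| ≤ K → |G s| ≤ K + 4 := fun K s hs =>
    le_of_tendsto (hGi s).abs
      ((eventually_ge_atTop 0).mono fun R hR => abs_scorer_truncation_le hs hR)
  have hlim : ∀ x, Tendsto (fun R : ℝ => ∫ s in (0 : ℝ)..x,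
      (x - s) * (s * (∫ t in (0 : ℝ)..R, Real.sin (s * t + t ^ 3 / 3)) - 1)) atTop
      (nhds (∫ s in (0 : ℝ)..x, (x - s) * (s * G s - 1))) := fun x => by
    refine intervalIntegral.tendsto_integral_filter_of_dominated_convergence
      (fun s => |x - s| * (|s| * (|x| + 4) + 1)) ?_ ?_ ?_ ?_
    · exact Eventually.of_forall fun R => Continuous.aestronglyMeasurable (by fun_prop)
    · filter_upwards [eventually_ge_atTop 0] with R hR
      refine Eventually.of_forall fun s hs => ?_
      have hsx : |s| ≤ |x| := by
        simpa using abs_le_max_abs_of_mem_uIoc hs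
      rw [norm_mul, Real.norm_eq_abs]
      refine mul_le_mul_of_nonneg_left ((norm_sub_le _ _).trans ?_) (abs_nonneg _)
      rw [norm_mul, norm_one, Real.norm_eq_abs, Real.norm_eq_abs]
      gcongr
      exact abs_scorer_truncation_le hsx hR
    · exact Continuous.intervalIntegrable (by fun_prop) _ _
    · exact Eventually.of_forall fun s _ =>
        (((hGi s).const_mul s).sub_const 1).const_mul (x - s)
  have hslope : ∀ x, Tendsto (fun R : ℝ => x * ∫ t in (0 : ℝ)..R, t * Real.cos (t ^ 3 / 3)) atTop
      (nhds (G x - G 0 - ∫ s in (0 : ℝ)..x, (x - s) * (s * G s - 1))) := fun x => by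
    have h := (((hGi x).sub (hGi 0)).sub (tendsto_integral_sub_mul_cos_phase x)).sub (hlim x)
    rw [sub_zero] at h
    refine h.congr fun R => ?_
    rw [scorer_truncation_eq R x]
    ring
  obtain ⟨c, hc⟩ : ∃ c, Tendsto (fun R : ℝ => ∫ t in (0 : ℝ)..R, t * Real.cos (t ^ 3 / 3))
      atTop (nhds c) := ⟨_, by simpa only [one_mul] using hslope 1⟩
  obtain ⟨h1, h2⟩ := hasDerivAt_of_eq_integral (c := c) hmeas hbdd fun x => by
    linarith [tendsto_nhds_unique (hslope x) (hc.const_mul x)]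
  have hpi := Real.pi_ne_zero
  have hGiG : Gi = fun x => Real.pi⁻¹ * G x := by
    funext x
    simp [hGdef, hpi]
  have hd1 : ∀ x, HasDerivAt Gi (Real.pi⁻¹ * (c + ∫ s in (0 : ℝ)..x, (s * G s - 1))) x := fun x => by
    rw [hGiG]
    exact (h1 x).const_mul _
  have hderiv : deriv Gi = fun x => Real.pi⁻¹ * (c + ∫ s in (0 : ℝ)..x, (s * G s - 1)) :=
    funext fun x => (hd1 x).deriv
  intro x
  have hd2 : HasDerivAt (deriv Gi) (Real.pi⁻¹ * (x * G x - 1)) x := by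
    rw [hderiv]
    exact (h2 x).const_mul _
  refine ⟨(hd1 x).differentiableAt, hd2.differentiableAt, ?_⟩
  rw [hd2.deriv]
  simp only [hGdef]
  field_simp
  ring
end

section
/- Define Bi(x) := Gi(x) + Hi(x) for x ∈ ℝ, i.e. Bi(x) = (1/π) lim_{R→∞} ∫₀^R sin(x t + t³/3) dt + (1/π) ∫₀^∞ exp(x t − t³/3) dt. Then Bi satisfies the homogeneous Airy equation: Bi is twice differentiable on ℝ and Bi''(x) − x · Bi(x) = 0 for every x ∈ ℝ. -/
open Filter MeasureTheory Set

/-- The integrand `exp (x a + b)` raised by a power of `a`; differentiation in `x` raises `n`. -/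
noncomputable def expMoment (a b : ℝ → ℂ) (n : ℕ) (x t : ℝ) : ℂ :=
  a t ^ n * Complex.exp (x * a t + b t)

lemma norm_expMoment_le {a b : ℝ → ℂ} {D : ℝ} {t : ℝ}
    (ha : ‖a t‖ ≤ t + 1) (hb : (b t).re ≤ D - t ^ 2) (n : ℕ) {x c : ℝ} (hx : |x| ≤ c) :
    ‖expMoment a b n x t‖ ≤
      n.factorial * Real.exp (c + 1 + D + (c + 2) ^ 2 / 4) * Real.exp (-t) := by
  have hpow : ‖a t‖ ^ n ≤ n.factorial * Real.exp ‖a t‖ := by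
    have := Real.pow_div_factorial_le_exp ‖a t‖ (norm_nonneg _) n
    rwa [div_le_iff₀' (by positivity)] at this
  have hre : x * (a t).re ≤ c * ‖a t‖ := by
    calc x * (a t).re ≤ |x * (a t).re| := le_abs_self _
      _ = |x| * |(a t).re| := abs_mul _ _
      _ ≤ c * ‖a t‖ := mul_le_mul hx (Complex.abs_re_le_norm _) (abs_nonneg _)
          ((abs_nonneg _).trans hx)
  have hc : 0 ≤ c := (abs_nonneg _).trans hx
  calc ‖expMoment a b n x t‖ = ‖a t‖ ^ n * Real.exp (x * (a t).re + (b t).re) := by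
        simp [expMoment, Complex.norm_exp]
    _ ≤ n.factorial * Real.exp ‖a t‖ * Real.exp (c * ‖a t‖ + (D - t ^ 2)) := by gcongr
    _ = n.factorial * Real.exp ((c + 1) * ‖a t‖ + (D - t ^ 2)) := by
        rw [mul_assoc, ← Real.exp_add]; ring_nf
    _ ≤ n.factorial * Real.exp ((c + 1 + D + (c + 2) ^ 2 / 4) + -t) := by
        refine mul_le_mul_of_nonneg_left (Real.exp_le_exp.2 ?_) (by positivity)
        nlinarith [mul_le_mul_of_nonneg_left ha (by linarith : 0 ≤ c + 1),
          sq_nonneg (t - (c + 2) / 2)]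
    _ = _ := by rw [Real.exp_add]; ring

section

variable {a b : ℝ → ℂ} {D : ℝ} {S : Set ℝ}

lemma integrableOn_expMoment (hac : Continuous a) (hbc : Continuous b) (hS : MeasurableSet S)
    (hS0 : S ⊆ Ioi 0) (ha : ∀ t ∈ S, ‖a t‖ ≤ t + 1) (hb : ∀ t ∈ S, (b t).re ≤ D - t ^ 2)
    (n : ℕ) (x : ℝ) : IntegrableOn (expMoment a b n x) S := by
  have hexp : IntegrableOn (fun t : ℝ => Real.exp (-t)) S :=
    (integrableOn_exp_neg_Ioi 0).mono_set hS0
  refine Integrable.mono' (hexp.const_mul _) ?_ ((ae_restrict_iff' hS).2 (.of_forall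
    fun t ht => norm_expMoment_le (ha t ht) (hb t ht) n le_rfl))
  exact Continuous.aestronglyMeasurable (by unfold expMoment; fun_prop)

lemma hasDerivAt_integral_expMoment (hac : Continuous a) (hbc : Continuous b)
    (hS : MeasurableSet S) (hS0 : S ⊆ Ioi 0) (ha : ∀ t ∈ S, ‖a t‖ ≤ t + 1)
    (hb : ∀ t ∈ S, (b t).re ≤ D - t ^ 2) (n : ℕ) (x : ℝ) :
    HasDerivAt (fun x => ∫ t in S, expMoment a b n x t)
      (∫ t in S, expMoment a b (n + 1) x t) x := by
  have hexp : IntegrableOn (fun t : ℝ => Real.exp (-t)) S :=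
    (integrableOn_exp_neg_Ioi 0).mono_set hS0
  refine (hasDerivAt_integral_of_dominated_loc_of_deriv_le (Metric.ball_mem_nhds x one_pos)
    (.of_forall fun y => (integrableOn_expMoment hac hbc hS hS0 ha hb n y).1)
    (integrableOn_expMoment hac hbc hS hS0 ha hb n x)
    (integrableOn_expMoment hac hbc hS hS0 ha hb (n + 1) x).1
    ((ae_restrict_iff' hS).2 (.of_forall fun t ht y hy =>
      norm_expMoment_le (ha t ht) (hb t ht) (n + 1) (c := |x| + 1) ?_))
    (hexp.const_mul _) (.of_forall fun t y _ => ?_)).2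
  · rw [Metric.mem_ball, Real.dist_eq] at hy
    linarith [abs_sub_abs_le_abs_sub y x]
  · have h : HasDerivAt (fun y : ℝ => (y : ℂ) * a t + b t) (1 * a t) y :=
      ((Complex.ofRealCLM.hasDerivAt (x := y)).mul_const (a t)).add_const _
    refine (h.cexp.const_mul (a t ^ n)).congr_deriv ?_
    simp only [expMoment]
    ring

/-- Where `a ^ 2 - x` times the integrand is `κ` times its derivative, the integral over a half
line solves an inhomogeneous Airy equation. -/
lemma integral_Ioi_expMoment_airy {a' b' : ℝ → ℂ} (hda : ∀ t, HasDerivAt a (a' t) t)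
    (hdb : ∀ t, HasDerivAt b (b' t) t) (κ : ℂ) (hκa : ∀ t, κ * a' t = -1)
    (hκb : ∀ t, κ * b' t = a t ^ 2) (ha : ∀ t ∈ Ioi (0 : ℝ), ‖a t‖ ≤ t + 1)
    (hb : ∀ t ∈ Ioi (0 : ℝ), (b t).re ≤ D - t ^ 2) (x : ℝ) :
    (∫ t in Ioi 0, expMoment a b 2 x t) - x * ∫ t in Ioi 0, expMoment a b 0 x t
      = -κ * Complex.exp (x * a 0 + b 0) := by
  have hac : Continuous a := continuous_iff_continuousAt.2 fun t => (hda t).continuousAt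
  have hbc : Continuous b := continuous_iff_continuousAt.2 fun t => (hdb t).continuousAt
  have hint := fun n =>
    integrableOn_expMoment hac hbc measurableSet_Ioi subset_rfl ha hb n x
  have hder : ∀ t, HasDerivAt (fun t => κ * expMoment a b 0 x t)
      (expMoment a b 2 x t - x * expMoment a b 0 x t) t := fun t => by
    have h : HasDerivAt (fun t => (x : ℂ) * a t + b t) (x * a' t + b' t) t :=
      ((hda t).const_mul _).add (hdb t)
    have h2 := h.cexp.const_mul κ
    simp only [expMoment, pow_zero, one_mul]
    refine h2.congr_deriv ?_
    linear_combination Complex.exp (x * a t + b t) * (x * hκa t + hκb t)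
  have hI := (hint 2).sub ((hint 0).const_mul (x : ℂ))
  rw [← integral_const_mul, ← integral_sub (hint 2) ((hint 0).const_mul _),
    integral_Ioi_of_hasDerivAt_of_tendsto' (fun t _ => hder t) hI
      (tendsto_zero_of_hasDerivAt_of_integrableOn_Ioi (a := 0) (fun t _ => hder t) hI
        ((hint 0).const_mul κ))]
  simp [expMoment]

end

/-- The integrand of `Hi`. -/
noncomputable def scorerHi (n : ℕ) (x : ℝ) : ℂ :=
  ∫ t in Ioi 0, expMoment (fun t => t) (fun t => -(t ^ 3 / 3 : ℂ)) n x t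

/-- The contribution of the segment from `0` to `I` to `Gi`. -/
noncomputable def scorerSegment (n : ℕ) (x : ℝ) : ℂ :=
  ∫ t in Ioc 0 1, expMoment (fun t => -t) (fun t => (t ^ 3 / 3 : ℂ)) n x t

/-- The contribution of the horizontal ray from `I` to `Gi`. -/
noncomputable def scorerRay (n : ℕ) (x : ℝ) : ℂ :=
  ∫ t in Ioi 0, expMoment (fun t => Complex.I * (t + Complex.I))
    (fun t => Complex.I * (t + Complex.I) ^ 3 / 3) n x t

lemma scorerHi_norm_bound : ∀ t ∈ Ioi (0 : ℝ), ‖(t : ℂ)‖ ≤ t + 1 := fun t ht => by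
  rw [Complex.norm_real, Real.norm_of_nonneg (le_of_lt ht)]; linarith

lemma scorerHi_re_bound :
    ∀ t ∈ Ioi (0 : ℝ), (-(t ^ 3 / 3 : ℂ)).re ≤ 4 / 3 - t ^ 2 := fun t ht => by
  have : (-(t ^ 3 / 3 : ℂ)) = ((-(t ^ 3 / 3) : ℝ) : ℂ) := by push_cast; ring
  rw [this, Complex.ofReal_re]
  nlinarith [mul_nonneg (add_nonneg (le_of_lt (mem_Ioi.1 ht)) zero_le_one) (sq_nonneg (t - 2))]

lemma scorerSegment_norm_bound : ∀ t ∈ Ioc (0 : ℝ) 1, ‖-(t : ℂ)‖ ≤ t + 1 := fun t ht => by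
  rw [norm_neg]; exact scorerHi_norm_bound t ht.1

lemma scorerSegment_re_bound :
    ∀ t ∈ Ioc (0 : ℝ) 1, (t ^ 3 / 3 : ℂ).re ≤ 4 / 3 - t ^ 2 := fun t ht => by
  have : (t ^ 3 / 3 : ℂ) = ((t ^ 3 / 3 : ℝ) : ℂ) := by push_cast; ring
  rw [this, Complex.ofReal_re]
  have h2 : t ^ 2 ≤ 1 := pow_le_one₀ ht.1.le ht.2
  have h3 : t ^ 3 ≤ 1 := pow_le_one₀ ht.1.le ht.2
  linarith

lemma scorerRay_norm_bound :
    ∀ t ∈ Ioi (0 : ℝ), ‖Complex.I * ((t : ℂ) + Complex.I)‖ ≤ t + 1 := fun t ht => by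
  rw [norm_mul, Complex.norm_I, one_mul]
  refine (norm_add_le _ _).trans ?_
  rw [Complex.norm_real, Real.norm_of_nonneg (le_of_lt ht), Complex.norm_I]

lemma re_I_mul_cube (t y : ℝ) :
    (Complex.I * ((t : ℂ) + y * Complex.I) ^ 3 / 3).re = y ^ 3 / 3 - t ^ 2 * y := by
  have h : Complex.I * ((t : ℂ) + y * Complex.I) ^ 3 / 3
      = ((y ^ 3 / 3 - t ^ 2 * y : ℝ) : ℂ) + ((t ^ 3 / 3 - t * y ^ 2 : ℝ) : ℂ) * Complex.I := by
    push_cast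
    linear_combination (t ^ 2 * y + t * y ^ 2 * Complex.I
      + y ^ 3 / 3 * (Complex.I ^ 2 - 1) : ℂ) * Complex.I_sq
  rw [h, Complex.add_re, Complex.ofReal_re, Complex.re_ofReal_mul, Complex.I_re]; ring

lemma scorerRay_re_bound :
    ∀ t ∈ Ioi (0 : ℝ),
      (Complex.I * ((t : ℂ) + Complex.I) ^ 3 / 3).re ≤ 4 / 3 - t ^ 2 := fun t _ => by
  have := re_I_mul_cube t 1
  rw [Complex.ofReal_one, one_mul] at this
  rw [this]; linarith

lemma hasDerivAt_scorerHi (n : ℕ) (x : ℝ) : HasDerivAt (scorerHi n) (scorerHi (n + 1) x) x :=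
  hasDerivAt_integral_expMoment (by fun_prop) (by fun_prop) measurableSet_Ioi subset_rfl
    scorerHi_norm_bound scorerHi_re_bound n x

lemma hasDerivAt_scorerSegment (n : ℕ) (x : ℝ) :
    HasDerivAt (scorerSegment n) (scorerSegment (n + 1) x) x :=
  hasDerivAt_integral_expMoment (by fun_prop) (by fun_prop) measurableSet_Ioc
    Ioc_subset_Ioi_self scorerSegment_norm_bound scorerSegment_re_bound n x

lemma hasDerivAt_scorerRay (n : ℕ) (x : ℝ) : HasDerivAt (scorerRay n) (scorerRay (n + 1) x) x :=
  hasDerivAt_integral_expMoment (by fun_prop) (by fun_prop) measurableSet_Ioi subset_rfl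
    scorerRay_norm_bound scorerRay_re_bound n x

lemma hasDerivAt_ofReal_complex (t : ℝ) : HasDerivAt (fun t : ℝ => (t : ℂ)) 1 t :=
  Complex.ofRealCLM.hasDerivAt

lemma scorerHi_airy (x : ℝ) : scorerHi 2 x - x * scorerHi 0 x = 1 := by
  have h := integral_Ioi_expMoment_airy (a := fun t => (t : ℂ)) (a' := fun _ => 1)
    (b := fun t => -(t ^ 3 / 3 : ℂ)) (b' := fun t => -(t ^ 2 : ℂ))
    hasDerivAt_ofReal_complex
    (fun t => (((hasDerivAt_ofReal_complex t).pow 3).div_const 3).neg.congr_deriv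
      (by push_cast; ring)) (-1) (fun _ => by ring) (fun _ => by ring)
    scorerHi_norm_bound scorerHi_re_bound x
  exact h.trans (by simp)

lemma scorerRay_airy (x : ℝ) :
    scorerRay 2 x - x * scorerRay 0 x = -Complex.I * Complex.exp (-x + 1 / 3) := by
  have hd : ∀ t : ℝ, HasDerivAt (fun t : ℝ => (t : ℂ) + Complex.I) 1 t := fun t =>
    (hasDerivAt_ofReal_complex t).add_const _
  have h := integral_Ioi_expMoment_airy (a := fun t => Complex.I * ((t : ℂ) + Complex.I))
    (a' := fun _ => Complex.I) (b := fun t => Complex.I * ((t : ℂ) + Complex.I) ^ 3 / 3)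
    (b' := fun t => Complex.I * ((t : ℂ) + Complex.I) ^ 2)
    (fun t => ((hd t).const_mul Complex.I).congr_deriv (by ring))
    (fun t => ((((hd t).pow 3).const_mul Complex.I).div_const 3).congr_deriv
      (by push_cast; ring)) Complex.I (fun _ => Complex.I_mul_I) (fun _ => by ring)
    scorerRay_norm_bound scorerRay_re_bound x
  refine h.trans ?_
  congr 2
  push_cast
  linear_combination (x + (Complex.I ^ 2 - 1) / 3) * Complex.I_sq

lemma scorerSegment_airy (x : ℝ) :
    scorerSegment 2 x - x * scorerSegment 0 x = Complex.exp (-x + 1 / 3) - 1 := by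
  have hint := fun n => integrableOn_expMoment (a := fun t => -(t : ℂ))
    (b := fun t => (t ^ 3 / 3 : ℂ)) (by fun_prop) (by fun_prop) measurableSet_Ioc
    Ioc_subset_Ioi_self scorerSegment_norm_bound scorerSegment_re_bound n x
  have hder : ∀ t : ℝ, HasDerivAt (expMoment (fun t => -(t : ℂ)) (fun t => (t ^ 3 / 3 : ℂ)) 0 x)
      (expMoment (fun t => -(t : ℂ)) (fun t => (t ^ 3 / 3 : ℂ)) 2 x t
        - x * expMoment (fun t => -(t : ℂ)) (fun t => (t ^ 3 / 3 : ℂ)) 0 x t) t := fun t => by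
    have h := (((hasDerivAt_ofReal_complex t).neg.const_mul (x : ℂ)).add
      (((hasDerivAt_ofReal_complex t).pow 3).div_const 3)).cexp
    unfold expMoment
    simp only [pow_zero, one_mul]
    refine h.congr_deriv ?_
    simp only [Pi.add_apply, Pi.neg_apply, Pi.pow_apply]
    push_cast
    ring
  have hI := (hint 2).sub ((hint 0).const_mul (x : ℂ))
  unfold scorerSegment
  rw [← integral_const_mul, ← integral_sub (hint 2) ((hint 0).const_mul _),
    ← intervalIntegral.integral_of_le zero_le_one,
    intervalIntegral.integral_eq_sub_of_hasDerivAt (fun t _ => hder t)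
      ((intervalIntegrable_iff_integrableOn_Ioc_of_le zero_le_one).2 hI)]
  simp [expMoment]

/-- The integral over `[0, R]` of `exp (I (x z + z ^ 3 / 3))`, moved to the line `im z = 1`. -/
lemma tendsto_integral_exp_airy_phase (x : ℝ) :
    Tendsto (fun R : ℝ => ∫ t in (0 : ℝ)..R, Complex.exp (Complex.I * (x * t + t ^ 3 / 3)))
      atTop (nhds (Complex.I * scorerSegment 0 x + scorerRay 0 x)) := by
  set f : ℂ → ℂ := fun z => Complex.exp (Complex.I * (x * z + z ^ 3 / 3)) with hf
  have hfd : Differentiable ℂ f := by fun_prop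
  have hfc : Continuous f := hfd.continuous
  have hrect : ∀ R : ℝ, (∫ t in (0 : ℝ)..R, f t) =
      Complex.I * (∫ y in (0 : ℝ)..1, f (y * Complex.I))
        + (∫ t in (0 : ℝ)..R, f (t + Complex.I))
        - Complex.I * ∫ y in (0 : ℝ)..1, f (R + y * Complex.I) := fun R => by
    have h := Complex.integral_boundary_rect_eq_zero_of_differentiableOn f 0 (R + Complex.I)
      hfd.differentiableOn
    simp at h
    linear_combination h
  have hnorm : ∀ t y : ℝ, ‖f (t + y * Complex.I)‖ =
      Real.exp (-(x * y) + (y ^ 3 / 3 - t ^ 2 * y)) := fun t y => by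
    rw [hf, Complex.norm_exp, ← re_I_mul_cube, mul_add, Complex.add_re, mul_div_assoc]
    simp
  have hseg : (∫ y in (0 : ℝ)..1, f (y * Complex.I)) = scorerSegment 0 x := by
    rw [intervalIntegral.integral_of_le zero_le_one]
    refine integral_congr_ae (.of_forall fun y => ?_)
    simp only [hf, expMoment, pow_zero, one_mul]
    congr 1
    linear_combination (x * y + y ^ 3 / 3 * (Complex.I ^ 2 - 1)) * Complex.I_sq
  have hray : ∀ t : ℝ, f (t + Complex.I) = expMoment (fun t => Complex.I * (t + Complex.I))
      (fun t => Complex.I * (t + Complex.I) ^ 3 / 3) 0 x t := fun t => by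
    simp only [hf, expMoment, pow_zero, one_mul]
    ring_nf
  have hrayt : Tendsto (fun R : ℝ => ∫ t in (0 : ℝ)..R, f (t + Complex.I)) atTop
      (nhds (scorerRay 0 x)) := by
    simp only [hray]
    exact intervalIntegral_tendsto_integral_Ioi 0 (integrableOn_expMoment (by fun_prop)
      (by fun_prop) measurableSet_Ioi subset_rfl scorerRay_norm_bound scorerRay_re_bound 0 x)
      tendsto_id
  have hvert : Tendsto (fun R : ℝ => ∫ y in (0 : ℝ)..1, f (R + y * Complex.I)) atTop
      (nhds 0) := by
    have h := intervalIntegral.tendsto_integral_filter_of_dominated_convergence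
      (μ := volume) (a := 0) (b := 1) (l := atTop) (F := fun R y : ℝ => f (R + y * Complex.I))
      (f := fun _ => 0)
      (fun _ => Real.exp (|x| + 1 / 3))
      (.of_forall fun R => Continuous.aestronglyMeasurable (by fun_prop))
      (.of_forall fun R => .of_forall fun y hy => ?_)
      intervalIntegrable_const
      (.of_forall fun y hy => ?_)
    · simpa using h
    · rw [uIoc_of_le zero_le_one] at hy
      rw [hnorm, Real.exp_le_exp]
      have h3 : y ^ 3 ≤ 1 := pow_le_one₀ hy.1.le hy.2
      have h1 : -x * y ≤ |x| := by
        nlinarith [neg_abs_le x, abs_nonneg x, hy.1, hy.2]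
      nlinarith [mul_nonneg (sq_nonneg R) hy.1.le]
    · rw [uIoc_of_le zero_le_one] at hy
      rw [tendsto_zero_iff_norm_tendsto_zero]
      simp only [hnorm]
      refine Real.tendsto_exp_atBot.comp (tendsto_atBot_add_const_left _ _ ?_)
      simp only [sub_eq_add_neg]
      exact tendsto_atBot_add_const_left _ _ (tendsto_neg_atTop_atBot.comp
        ((tendsto_pow_atTop two_ne_zero).atTop_mul_const hy.1))
  have hlim := (hrayt.const_add (Complex.I * scorerSegment 0 x)).sub
    (hvert.const_mul Complex.I)
  simp only [mul_zero, sub_zero] at hlim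
  refine hlim.congr fun R => ?_
  rw [← hseg]
  exact (hrect R).symm

lemma tendsto_integral_sin_airy_phase (x : ℝ) :
    Tendsto (fun R : ℝ => ∫ t in (0 : ℝ)..R, Real.sin (x * t + t ^ 3 / 3))
      atTop (nhds (Complex.I * scorerSegment 0 x + scorerRay 0 x).im) := by
  refine ((Complex.continuous_im.tendsto _).comp (tendsto_integral_exp_airy_phase x)).congr
    fun R => ?_
  have h := Complex.imCLM.intervalIntegral_comp_comm
    (μ := volume) (a := 0) (b := R)
    (f := fun t : ℝ => Complex.exp (Complex.I * (x * t + t ^ 3 / 3)))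
    (Continuous.intervalIntegrable (by fun_prop) _ _)
  refine h.symm.trans (intervalIntegral.integral_congr fun t _ => ?_)
  have : Complex.I * ((x : ℂ) * t + t ^ 3 / 3) = ((x * t + t ^ 3 / 3 : ℝ) : ℂ) * Complex.I := by
    push_cast; ring
  simp only [Complex.imCLM_apply, this, Complex.exp_ofReal_mul_I_im]

lemma ofReal_integral_exp_airy_phase (x : ℝ) :
    ((∫ t in Ioi (0 : ℝ), Real.exp (x * t - t ^ 3 / 3) : ℝ) : ℂ) = scorerHi 0 x := by
  rw [← integral_complex_ofReal]
  refine integral_congr_ae (.of_forall fun t => ?_)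
  simp [expMoment, sub_eq_add_neg]

theorem scorer_Bi_homogeneous_airy (Gi : ℝ → ℝ)
    (hGi : ∀ x : ℝ, Tendsto (fun R : ℝ => ∫ t in (0 : ℝ)..R, Real.sin (x * t + t ^ 3 / 3))
      atTop (nhds (Real.pi * Gi x))) :
    ∀ Bi : ℝ → ℝ,
      (∀ x : ℝ, Bi x = Gi x +
        (1 / Real.pi) * ∫ t in Ioi (0 : ℝ), Real.exp (x * t - t ^ 3 / 3)) →
      ∀ x : ℝ, DifferentiableAt ℝ Bi x ∧ DifferentiableAt ℝ (deriv Bi) x ∧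
        deriv (deriv Bi) x - x * Bi x = 0 := by
  intro Bi hBi x
  let B : ℕ → ℝ → ℂ := fun n x =>
    Complex.I * (scorerHi n x + scorerSegment n x) + scorerRay n x
  have hB : ∀ n x, HasDerivAt (fun x => (B n x).im / Real.pi)
      ((B (n + 1) x).im / Real.pi) x := fun n x =>
    (Complex.imCLM.hasFDerivAt.comp_hasDerivAt x
      ((((hasDerivAt_scorerHi n x).add (hasDerivAt_scorerSegment n x)).const_mul Complex.I).add
        (hasDerivAt_scorerRay n x))).div_const Real.pi
  have hBi0 : Bi = fun x => (B 0 x).im / Real.pi := funext fun y => by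
    have hG := tendsto_nhds_unique (hGi y) (tendsto_integral_sin_airy_phase y)
    have hH : (∫ t in Ioi (0 : ℝ), Real.exp (y * t - t ^ 3 / 3))
        = (Complex.I * scorerHi 0 y).im := by
      rw [← ofReal_integral_exp_airy_phase]; simp
    have hsum : (B 0 y).im = Real.pi * Gi y + (Complex.I * scorerHi 0 y).im := by
      rw [hG, ← Complex.add_im]
      simp only [B]
      ring_nf
    rw [hBi, hH, hsum]
    field_simp
  have hBi1 : deriv Bi = fun x => (B 1 x).im / Real.pi := by
    rw [hBi0]; exact funext fun y => (hB 0 y).deriv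
  have hairy : B 2 x - x * B 0 x = 0 := by
    simp only [B]
    linear_combination Complex.I * scorerHi_airy x + Complex.I * scorerSegment_airy x
      + scorerRay_airy x
  refine ⟨hBi0 ▸ (hB 0 x).differentiableAt, hBi1 ▸ (hB 1 x).differentiableAt, ?_⟩
  rw [hBi1, (hB 1 x).deriv, hBi0]
  have him := congrArg Complex.im hairy
  rw [Complex.sub_im, Complex.im_ofReal_mul, Complex.zero_im] at him
  linear_combination him / Real.pi
end

section
/- The value of the Scorer function Gi at the origin is Gi(0) = 1/(3^{7/6} Γ(2/3)); equivalently, lim_{R→∞} ∫₀^R sin(t³/3) dt = π/(3^{7/6} Γ(2/3)), where Γ is the Gamma function. -/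
open Filter

/-- The antiderivative of `exp (-z ^ 3 / 3)` varies by at most `3 / R ^ 2` along the vertical segment
from `R` to `R * (1 - I / √3)`. -/
lemma norm_sub_le_of_hasDerivAt_exp_neg_cube {H : ℂ → ℂ}
    (hH : ∀ z, HasDerivAt H (Complex.exp (-(z ^ 3 / 3))) z) {R : ℝ} (hR : 0 < R) :
    ‖H (R * (1 - Complex.I / (√3 : ℝ))) - H R‖ ≤ 3 / R ^ 2 := by
  have h3 : (√3 : ℝ) ^ 2 = 3 := Real.sq_sqrt (by norm_num)
  have h3pos : (0 : ℝ) < √3 := by positivity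
  have h31 : (1 : ℝ) ≤ √3 := by nlinarith
  set w : ℂ := -(R * (Complex.I / (√3 : ℝ))) with hw
  have hwI : w = ((-(R / √3) : ℝ) : ℂ) * Complex.I := by
    rw [hw]; push_cast; ring
  have hwn : ‖w‖ ≤ R := by
    rw [hwI, norm_mul, Complex.norm_I, mul_one, Complex.norm_real, norm_neg, Real.norm_eq_abs,
      abs_of_pos (by positivity)]
    exact div_le_self hR.le h31
  have hpath (x : ℝ) : HasDerivAt (fun x : ℝ => H (R + x * w) - H R)
      (Complex.exp (-((R + x * w) ^ 3 / 3)) * w) x := by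
    have h1 : HasDerivAt (fun x : ℝ => (R : ℂ) + x * w) w x := by
      simpa using ((Complex.ofRealCLM.hasDerivAt (x := x)).mul_const w).const_add (R : ℂ)
    exact ((hH _).comp x h1).sub_const _
  have hB (x : ℝ) : HasDerivAt (fun x : ℝ => 3 / R ^ 2 * Real.exp (-(R ^ 3 * (1 - x) / 3)))
      (R * Real.exp (-(R ^ 3 * (1 - x) / 3))) x := by
    have h1 : HasDerivAt (fun x : ℝ => -(R ^ 3 * (1 - x) / 3)) (R ^ 3 / 3) x := by
      convert! ((((hasDerivAt_id x).const_sub 1).const_mul (R ^ 3)).div_const 3).neg using 1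
      ring
    convert! h1.exp.const_mul (3 / R ^ 2) using 1
    field_simp
  have key := image_norm_le_of_norm_deriv_right_le_deriv_boundary (a := 0) (b := 1)
    (fun x _ => (hpath x).continuousAt.continuousWithinAt)
    (fun x _ => (hpath x).hasDerivWithinAt) (by simp; positivity) hB
    (fun x hx => by
      rw [norm_mul, mul_comm]
      refine mul_le_mul hwn ?_ (norm_nonneg _) hR.le
      rw [Complex.norm_exp, Real.exp_le_exp]
      have hre : (-(((R : ℂ) + x * w) ^ 3 / 3)).re = -(R ^ 3 * (1 - x ^ 2) / 3) := by
        have hz : -(((R : ℂ) + x * w) ^ 3 / 3) =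
            ((-((R ^ 3 - 3 * R * (x * (R / √3)) ^ 2) / 3) : ℝ) : ℂ) +
            (((3 * R ^ 2 * (x * (R / √3)) - (x * (R / √3)) ^ 3) / 3 : ℝ) : ℂ) * Complex.I := by
          rw [hwI]
          push_cast
          linear_combination (-(R * (x * (R / (√3 : ℝ))) ^ 2) +
            (x * (R / (√3 : ℝ))) ^ 3 / 3 * Complex.I : ℂ) * Complex.I_sq
        rw [hz, Complex.add_re, Complex.ofReal_re, Complex.re_ofReal_mul, Complex.I_re, mul_pow,
          div_pow, h3]
        ring
      rw [hre]
      have : x ^ 2 ≤ x := by nlinarith [hx.1, hx.2]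
      gcongr)
    (Set.right_mem_Icc.2 zero_le_one)
  have hend : (R : ℂ) * (1 - Complex.I / (√3 : ℝ)) = R + (1 : ℝ) * w := by
    rw [hw]; push_cast; ring
  rw [hend]
  simpa using key

lemma tendsto_integral_exp_neg_cube :
    Tendsto (fun R : ℝ => ∫ t in (0 : ℝ)..R, Real.exp (-(t ^ 3 / 3))) atTop
      (nhds ((3 : ℝ) ^ ((1 : ℝ) / 3) * Real.Gamma (4 / 3))) := by
  have hfun : (fun t : ℝ => Real.exp (-(1 / 3) * t ^ (3 : ℝ))) =
      fun t : ℝ => Real.exp (-(t ^ 3 / 3)) := by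
    ext t
    rw [show (3 : ℝ) = ((3 : ℕ) : ℝ) by norm_num, Real.rpow_natCast]
    push_cast
    ring_nf
  have hval := integral_exp_neg_mul_rpow (p := 3) (b := 1 / 3) (by norm_num) (by norm_num)
  have hint := integrableOn_rpow_mul_exp_neg_mul_rpow (p := 3) (s := 0) (b := 1 / 3)
    (by norm_num) (by norm_num) (by norm_num)
  simp only [Real.rpow_zero, one_mul, hfun] at hint
  rw [hfun] at hval
  have h := MeasureTheory.intervalIntegral_tendsto_integral_Ioi 0 hint tendsto_id
  rw [hval] at h
  have hconst : (1 / 3 : ℝ) ^ (-1 / 3 : ℝ) * Real.Gamma (1 / 3 + 1) =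
      (3 : ℝ) ^ ((1 : ℝ) / 3) * Real.Gamma (4 / 3) := by
    rw [one_div (3 : ℝ), Real.inv_rpow (by norm_num), ← Real.rpow_neg (by norm_num)]
    norm_num
  rwa [hconst] at h

lemma tendsto_integral_exp_I_cube :
    Tendsto (fun R : ℝ => ∫ t in (0 : ℝ)..R, Complex.exp ((t ^ 3 / 3 : ℝ) * Complex.I)) atTop
      (nhds (((3 : ℝ) ^ ((1 : ℝ) / 3) * Real.Gamma (4 / 3) : ℝ) *
        (((√3 : ℝ) + Complex.I) / 2))) := by
  have hdiff : Differentiable ℂ fun z : ℂ => Complex.exp (-(z ^ 3 / 3)) := by fun_prop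
  obtain ⟨H, hH⟩ := hdiff.isExactOn_univ
  replace hH (z : ℂ) := hH z (Set.mem_univ z)
  have h3 : (√3 : ℝ) ^ 2 = 3 := Real.sq_sqrt (by norm_num)
  have h3pos : (0 : ℝ) < √3 := by positivity
  have h3C : ((√3 : ℝ) : ℂ) ^ 2 = 3 := by exact_mod_cast h3
  have h3C0 : ((√3 : ℝ) : ℂ) ≠ 0 := by exact_mod_cast h3pos.ne'
  have hray (v : ℂ) (R : ℝ) :
      ∫ t in (0 : ℝ)..R, Complex.exp (-((t * v) ^ 3 / 3)) * v = H (R * v) - H 0 := by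
    have h1 (t : ℝ) : HasDerivAt (fun t : ℝ => H (t * v))
        (Complex.exp (-((t * v) ^ 3 / 3)) * v) t := by
      have h2 : HasDerivAt (fun t : ℝ => (t : ℂ) * v) v t := by
        simpa using (Complex.ofRealCLM.hasDerivAt (x := t)).mul_const v
      exact (hH _).comp t h2
    rw [intervalIntegral.integral_eq_sub_of_hasDerivAt (fun t _ => h1 t)
      (Continuous.intervalIntegrable (by fun_prop) _ _)]
    simp
  have hreal : Tendsto (fun R : ℝ => H R - H 0) atTop
      (nhds (((3 : ℝ) ^ ((1 : ℝ) / 3) * Real.Gamma (4 / 3) : ℝ) : ℂ)) := by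
    refine ((Complex.continuous_ofReal.tendsto _).comp tendsto_integral_exp_neg_cube).congr
      fun R => ?_
    have := hray 1 R
    simp only [mul_one] at this
    rw [← this, Function.comp_apply, ← intervalIntegral.integral_ofReal]
    push_cast
    rfl
  have hzero : Tendsto (fun R : ℝ => H (R * (1 - Complex.I / (√3 : ℝ))) - H R) atTop (nhds 0) := by
    refine squeeze_zero_norm' (a := fun R : ℝ => 3 / R ^ 2) ?_
      (tendsto_const_nhds.div_atTop (tendsto_pow_atTop two_ne_zero))
    filter_upwards [eventually_gt_atTop 0] with R hR
    exact norm_sub_le_of_hasDerivAt_exp_neg_cube hH hR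
  -- `v` has modulus one and direction `-π / 6`, so that `v ^ 3 = -I`.
  set v : ℂ := ((√3 : ℝ) - Complex.I) / 2 with hv
  have hv3 : v ^ 3 = -Complex.I := by
    rw [hv]
    linear_combination ((√3 : ℝ) - 3 * Complex.I) / 8 * h3C
      + (3 * (√3 : ℝ) - Complex.I) / 8 * Complex.I_sq
  have hvv : v * (((√3 : ℝ) + Complex.I) / 2) = 1 := by
    rw [hv]
    linear_combination h3C / 4 - Complex.I_sq / 4
  have hv0 : v ≠ 0 := left_ne_zero_of_mul_eq_one hvv
  have hscale : Tendsto (fun R : ℝ => √3 / 2 * R) atTop atTop :=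
    tendsto_id.const_mul_atTop (by positivity)
  have hlim := ((hzero.add hreal).comp hscale).mul_const (((√3 : ℝ) + Complex.I) / 2)
  rw [zero_add] at hlim
  refine hlim.congr fun R => ?_
  have hRv : ((√3 / 2 * R : ℝ) : ℂ) * (1 - Complex.I / (√3 : ℝ)) = R * v := by
    rw [hv]
    push_cast
    field_simp
  have hexp (t : ℝ) : -(((t : ℂ) * v) ^ 3 / 3) = ((t ^ 3 / 3 : ℝ) : ℂ) * Complex.I := by
    rw [mul_pow, hv3]
    push_cast
    ring
  have hR := hray v R
  simp only [hexp, intervalIntegral.integral_mul_const] at hR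
  simp only [Function.comp_apply, hRv]
  rw [sub_add_sub_cancel, ← hR, mul_assoc, hvv, mul_one]

lemma tendsto_integral_sin_cube :
    Tendsto (fun R : ℝ => ∫ t in (0 : ℝ)..R, Real.sin (t ^ 3 / 3)) atTop
      (nhds ((3 : ℝ) ^ ((1 : ℝ) / 3) * Real.Gamma (4 / 3) / 2)) := by
  have h := (Complex.continuous_im.tendsto _).comp tendsto_integral_exp_I_cube
  convert! h using 2 with R
  · have hc : Continuous fun t : ℝ => Complex.exp ((t ^ 3 / 3 : ℝ) * Complex.I) := by fun_prop
    have := Complex.imCLM.intervalIntegral_comp_comm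
      (hc.intervalIntegrable (μ := MeasureTheory.volume) 0 R)
    simpa only [Complex.imCLM_apply, Complex.exp_ofReal_mul_I_im, Function.comp_apply] using this
  · rw [Complex.im_ofReal_mul]
    simp
    ring

lemma three_rpow_mul_Gamma_four_thirds :
    (3 : ℝ) ^ ((1 : ℝ) / 3) * Real.Gamma (4 / 3) / 2 =
      Real.pi / ((3 : ℝ) ^ ((7 : ℝ) / 6) * Real.Gamma (2 / 3)) := by
  have h1 : Real.Gamma (4 / 3) = 1 / 3 * Real.Gamma (1 / 3) := by
    rw [← Real.Gamma_add_one (by norm_num)]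
    norm_num
  have h2 : Real.Gamma (1 / 3) * Real.Gamma (2 / 3) = Real.pi / (√3 / 2) := by
    have := Real.Gamma_mul_Gamma_one_sub (1 / 3)
    rw [show Real.pi * (1 / 3) = Real.pi / 3 by ring, Real.sin_pi_div_three] at this
    rw [← this]
    norm_num
  have h3 : (3 : ℝ) ^ ((1 : ℝ) / 3) * (3 : ℝ) ^ ((7 : ℝ) / 6) = 3 * √3 := by
    rw [Real.sqrt_eq_rpow, ← Real.rpow_add (by norm_num),
      ← Real.rpow_one_add' (by norm_num) (by norm_num)]
    norm_num
  have hG : Real.Gamma (2 / 3) ≠ 0 := (Real.Gamma_pos_of_pos (by norm_num)).ne'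
  have h7 : (3 : ℝ) ^ ((7 : ℝ) / 6) ≠ 0 := by positivity
  rw [eq_div_iff (mul_ne_zero h7 hG), h1]
  calc _ = ((3 : ℝ) ^ ((1 : ℝ) / 3) * (3 : ℝ) ^ ((7 : ℝ) / 6)) *
        (Real.Gamma (1 / 3) * Real.Gamma (2 / 3)) / 6 := by ring
    _ = Real.pi := by
      rw [h2, h3]
      field_simp
      norm_num

theorem scorer_Gi_zero (Gi : ℝ → ℝ)
    (hGi : ∀ x : ℝ, Tendsto (fun R : ℝ => ∫ t in (0 : ℝ)..R, Real.sin (x * t + t ^ 3 / 3))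
      atTop (nhds (Real.pi * Gi x))) :
    Gi 0 = 1 / ((3 : ℝ) ^ ((7 : ℝ) / 6) * Real.Gamma (2 / 3)) ∧
      Tendsto (fun R : ℝ => ∫ t in (0 : ℝ)..R, Real.sin (t ^ 3 / 3)) atTop
        (nhds (Real.pi / ((3 : ℝ) ^ ((7 : ℝ) / 6) * Real.Gamma (2 / 3)))) := by
  have hlim := tendsto_integral_sin_cube
  rw [three_rpow_mul_Gamma_four_thirds] at hlim
  refine ⟨?_, hlim⟩
  have h0 := hGi 0
  simp only [zero_mul, zero_add] at h0
  have := tendsto_nhds_unique h0 hlim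
  rw [div_eq_mul_one_div] at this
  exact mul_left_cancel₀ Real.pi_ne_zero this
end

section
/- The derivative of the Scorer function Gi at the origin is Gi'(0) = 1/(3^{5/6} Γ(1/3)); equivalently, lim_{R→∞} ∫₀^R t · cos(t³/3) dt = π/(3^{5/6} Γ(1/3)), where Γ is the Gamma function. -/
open Filter

/-- The integrand `zⁿ exp (i (x z + z³ / 3))` of the Airy and Scorer functions (`n = 0`) and,
up to the factor `i`, of their derivatives (`n = 1`). -/
noncomputable def airyKernel (n : ℕ) (x : ℝ) (z : ℂ) : ℂ :=
  z ^ n * Complex.exp (Complex.I * (x * z + z ^ 3 / 3))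

/-- The sixth part of a half-turn, `exp (i π / 6)`. -/
noncomputable def airyRay : ℂ := Complex.exp ((Real.pi / 6 : ℝ) * Complex.I)

lemma airyRay_eq : airyRay = (√3 / 2 : ℝ) + (1 / 2 : ℝ) * Complex.I := by
  rw [airyRay, Complex.exp_mul_I, ← Complex.ofReal_cos, ← Complex.ofReal_sin,
    Real.cos_pi_div_six, Real.sin_pi_div_six]

lemma airyRay_pow_three : airyRay ^ 3 = Complex.I := by
  rw [airyRay, ← Complex.exp_nat_mul]
  convert Complex.exp_pi_div_two_mul_I using 2
  push_cast
  ring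

lemma norm_airyRay : ‖airyRay‖ = 1 := Complex.norm_exp_ofReal_mul_I _

lemma differentiable_airyKernel (n : ℕ) (x : ℝ) : Differentiable ℂ (airyKernel n x) := by
  unfold airyKernel
  fun_prop

/-- Rotating a segment starting at the origin changes the integral of an entire function by the
integral over the circular arc swept by the end point. -/
lemma integral_sub_integral_rotated {f : ℂ → ℂ} (hf : Differentiable ℂ f) (R α : ℝ) :
    (∫ t in (0 : ℝ)..R, f t) -
      ∫ s in (0 : ℝ)..R, Complex.exp (α * Complex.I) * f (Complex.exp (α * Complex.I) * s) =
    -∫ θ in (0 : ℝ)..α,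
      R * Complex.exp (θ * Complex.I) * Complex.I * f (R * Complex.exp (θ * Complex.I)) := by
  obtain ⟨F, hF⟩ := hf.isExactOn_univ
  have hF' : ∀ z, HasDerivAt F (f z) z := fun z => hF z (Set.mem_univ z)
  have hc : Continuous f := hf.continuous
  have h1 : ∫ t in (0 : ℝ)..R, f t = F R - F 0 := by
    have := intervalIntegral.integral_eq_sub_of_hasDerivAt (a := 0) (b := R)
      (f := fun t : ℝ => F t) (f' := fun t : ℝ => f t)
      (fun t _ => (hF' t).comp_ofReal) (Continuous.intervalIntegrable (by fun_prop) _ _)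
    simpa using this
  have h2 : ∫ s in (0 : ℝ)..R,
      Complex.exp (α * Complex.I) * f (Complex.exp (α * Complex.I) * s) =
        F (Complex.exp (α * Complex.I) * R) - F 0 := by
    have := intervalIntegral.integral_eq_sub_of_hasDerivAt (a := 0) (b := R)
      (f := fun t : ℝ => F (Complex.exp (α * Complex.I) * t))
      (f' := fun s : ℝ => Complex.exp (α * Complex.I) * f (Complex.exp (α * Complex.I) * s))
      (fun t _ => by
        have hd : HasDerivAt (fun t : ℝ => Complex.exp (α * Complex.I) * (t : ℂ))
            (Complex.exp (α * Complex.I)) t := by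
          simpa using (Complex.ofRealCLM.hasDerivAt (x := t)).const_mul
            (Complex.exp (α * Complex.I))
        have := (hF' (Complex.exp (α * Complex.I) * t)).comp t hd
        exact this.congr_deriv (mul_comm _ _))
      (Continuous.intervalIntegrable (by fun_prop) _ _)
    simpa using this
  have h3 : ∫ θ in (0 : ℝ)..α,
      R * Complex.exp (θ * Complex.I) * Complex.I * f (R * Complex.exp (θ * Complex.I)) =
        F (R * Complex.exp (α * Complex.I)) - F R := by
    have := intervalIntegral.integral_eq_sub_of_hasDerivAt (a := 0) (b := α)
      (f := fun θ : ℝ => F (R * Complex.exp (θ * Complex.I)))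
      (f' := fun θ : ℝ =>
        R * Complex.exp (θ * Complex.I) * Complex.I * f (R * Complex.exp (θ * Complex.I)))
      (fun θ _ => by
        have hd : HasDerivAt (fun θ : ℝ => R * Complex.exp ((θ : ℂ) * Complex.I))
            (R * Complex.exp (θ * Complex.I) * Complex.I) θ := by
          have h0 : HasDerivAt (fun θ : ℝ => (θ : ℂ) * Complex.I) Complex.I θ := by
            simpa using (Complex.ofRealCLM.hasDerivAt (x := θ)).mul_const Complex.I
          simpa [mul_assoc] using (h0.cexp.const_mul (R : ℂ))
        have := (hF' (R * Complex.exp (θ * Complex.I))).comp θ hd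
        exact this.congr_deriv (mul_comm _ _))
      (Continuous.intervalIntegrable (by fun_prop) _ _)
    simpa using this
  rw [h1, h2, h3, mul_comm (Complex.exp _)]
  ring

lemma norm_airyKernel_arc_le {n : ℕ} (hn : n ≤ 1) {x R θ : ℝ} (hx : |x| ≤ 1) (hR : 2 ≤ R)
    (h0 : 0 ≤ θ) (h1 : θ ≤ Real.pi / 6) :
    R * ‖airyKernel n x (R * Complex.exp (θ * Complex.I))‖ ≤
      R ^ 2 * Real.exp (-(R ^ 3 / 4) * θ) := by
  have hre : (Complex.I * (x * (R * Complex.exp (θ * Complex.I)) +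
      (R * Complex.exp (θ * Complex.I)) ^ 3 / 3)).re =
        -(x * (R * Real.sin θ) + R ^ 3 * Real.sin (3 * θ) / 3) := by
    have h3 : Complex.exp (θ * Complex.I) ^ 3 = Complex.exp ((3 * θ : ℝ) * Complex.I) := by
      rw [← Complex.exp_nat_mul]
      congr 1
      push_cast
      ring
    have hz : (Complex.I * (x * (R * Complex.exp (θ * Complex.I)) +
      (R * Complex.exp (θ * Complex.I)) ^ 3 / 3)) =
        Complex.I * (((x * R : ℝ) : ℂ) * Complex.exp (θ * Complex.I) +
          ((R ^ 3 / 3 : ℝ) : ℂ) * Complex.exp ((3 * θ : ℝ) * Complex.I)) := by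
      rw [mul_pow, h3]
      push_cast
      ring
    rw [hz, Complex.I_mul_re, Complex.add_im, Complex.im_ofReal_mul, Complex.im_ofReal_mul,
      Complex.exp_ofReal_mul_I_im, Complex.exp_ofReal_mul_I_im]
    ring
  have hsin3 : 3 / 2 * θ ≤ Real.sin (3 * θ) := by
    have h := Real.mul_le_sin (x := 3 * θ) (by linarith) (by linarith)
    have h2 : 1 / 2 ≤ 2 / Real.pi := by
      rw [div_le_div_iff₀ two_pos Real.pi_pos]
      linarith [Real.pi_le_four]
    nlinarith
  have hsin : |x * (R * Real.sin θ)| ≤ R * θ := by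
    have hs : |Real.sin θ| ≤ θ := by
      simpa [abs_of_nonneg h0] using Real.abs_sin_le_abs (x := θ)
    rw [abs_mul, abs_mul, abs_of_nonneg (by linarith : (0 : ℝ) ≤ R)]
    have : R * |Real.sin θ| ≤ R * θ := by gcongr
    nlinarith [mul_nonneg (by linarith : (0 : ℝ) ≤ R) (abs_nonneg (Real.sin θ))]
  have hexp : -(x * (R * Real.sin θ) + R ^ 3 * Real.sin (3 * θ) / 3) ≤ -(R ^ 3 / 4) * θ := by
    have hA : R ^ 3 * (3 / 2 * θ) ≤ R ^ 3 * Real.sin (3 * θ) := by gcongr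
    have hB : 4 * R ≤ R ^ 3 := by
      nlinarith [mul_nonneg (by linarith : (0 : ℝ) ≤ R) (by nlinarith : 0 ≤ R ^ 2 - 4)]
    have hC : 4 * R * θ ≤ R ^ 3 * θ := by gcongr
    have := neg_abs_le (x * (R * Real.sin θ))
    nlinarith
  have hRn : ‖(R * Complex.exp (θ * Complex.I))‖ = R := by
    rw [norm_mul, Complex.norm_exp_ofReal_mul_I, Complex.norm_real, Real.norm_eq_abs,
      abs_of_nonneg (by linarith), mul_one]
  rw [airyKernel, norm_mul, norm_pow, Complex.norm_exp, hre, hRn, ← mul_assoc, ← pow_succ']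
  gcongr
  · linarith
  · omega

lemma norm_arc_integral_airyKernel_le {n : ℕ} (hn : n ≤ 1) {x R : ℝ} (hx : |x| ≤ 1)
    (hR : 2 ≤ R) :
    ‖∫ θ in (0 : ℝ)..(Real.pi / 6), R * Complex.exp (θ * Complex.I) * Complex.I *
      airyKernel n x (R * Complex.exp (θ * Complex.I))‖ ≤ 4 / R := by
  have hpi : 0 ≤ Real.pi / 6 := by positivity
  have hR0 : 0 < R := by linarith
  have hc : -(R ^ 3 / 4) ≠ 0 := by
    have : 0 < R ^ 3 := by positivity
    linarith
  calc _ ≤ ∫ θ in (0 : ℝ)..(Real.pi / 6), R ^ 2 * Real.exp (-(R ^ 3 / 4) * θ) := by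
        refine intervalIntegral.norm_integral_le_of_norm_le hpi ?_
          (Continuous.intervalIntegrable (by fun_prop) _ _)
        refine Eventually.of_forall fun θ hθ => ?_
        have := norm_airyKernel_arc_le hn hx hR hθ.1.le hθ.2
        simpa [Complex.norm_exp_ofReal_mul_I, abs_of_pos hR0] using this
    _ = 4 / R * (1 - Real.exp (-(R ^ 3 / 4) * (Real.pi / 6))) := by
        rw [intervalIntegral.integral_const_mul,
          intervalIntegral.integral_comp_mul_left (fun y => Real.exp y) hc, integral_exp]
        simp only [mul_zero, Real.exp_zero, smul_eq_mul]
        field_simp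
        ring
    _ ≤ 4 / R := by
        have : 0 < 4 / R := by positivity
        nlinarith [Real.exp_pos (-(R ^ 3 / 4) * (Real.pi / 6))]

lemma rotated_airyKernel (n : ℕ) (x s : ℝ) :
    airyRay * airyKernel n x (airyRay * s) =
      airyRay ^ (n + 1) * s ^ n * Complex.exp (Complex.I * airyRay * x * s - s ^ 3 / 3) := by
  have h : Complex.I * (x * (airyRay * s) + (airyRay * s) ^ 3 / 3) =
      Complex.I * airyRay * x * s - s ^ 3 / 3 := by
    rw [mul_pow, airyRay_pow_three]
    linear_combination (s ^ 3 / 3 : ℂ) * Complex.I_sq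
  rw [airyKernel, h]
  ring

lemma norm_rotated_airyKernel_le (n : ℕ) {x s : ℝ} (hx : |x| ≤ 1) (hs : 0 ≤ s) :
    ‖airyRay * airyKernel n x (airyRay * s)‖ ≤ s ^ n * Real.exp (2 - s) := by
  rw [rotated_airyKernel, norm_mul, norm_mul, norm_pow, norm_pow, norm_airyRay, one_pow, one_mul,
    Complex.norm_real, Real.norm_of_nonneg hs, Complex.norm_exp]
  have hre : (Complex.I * airyRay * x * s - s ^ 3 / 3).re = -(x * s / 2) - s ^ 3 / 3 := by
    have : Complex.I * airyRay * x * s - s ^ 3 / 3 =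
        ((-(x * s / 2) - s ^ 3 / 3 : ℝ) : ℂ) + ((√3 / 2 * x * s : ℝ) : ℂ) * Complex.I := by
      rw [airyRay_eq]
      push_cast
      linear_combination (x * s / 2 : ℂ) * Complex.I_sq
    rw [this, Complex.add_re, Complex.re_ofReal_mul, Complex.I_re, Complex.ofReal_re, mul_zero,
      add_zero]
  rw [hre]
  have hxs : -(x * s) ≤ s := by nlinarith [neg_abs_le x]
  have hcube : 2 * s - s ^ 3 / 3 ≤ 2 := by
    nlinarith [mul_nonneg hs (sq_nonneg (s - 3 / 2)), sq_nonneg (s - 3 / 2)]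
  exact mul_le_mul_of_nonneg_left (Real.exp_le_exp.2 (by linarith)) (pow_nonneg hs n)

lemma integrableOn_pow_mul_exp_two_sub (n : ℕ) :
    MeasureTheory.IntegrableOn (fun s : ℝ => s ^ n * Real.exp (2 - s)) (Set.Ioi 0) := by
  have h := (Real.GammaIntegral_convergent (s := n + 1) (by positivity)).const_mul (Real.exp 2)
  refine h.congr (Eventually.of_forall fun s => ?_)
  beta_reduce
  rw [add_sub_cancel_right, Real.rpow_natCast, sub_eq_add_neg 2, Real.exp_add]
  ring

lemma integrableOn_rotated_airyKernel (n : ℕ) {x : ℝ} (hx : |x| ≤ 1) :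
    MeasureTheory.IntegrableOn (fun s : ℝ => airyRay * airyKernel n x (airyRay * s))
      (Set.Ioi 0) := by
  refine (integrableOn_pow_mul_exp_two_sub n).mono' ?_ ?_
  · have := (differentiable_airyKernel n x).continuous
    exact Continuous.aestronglyMeasurable (by fun_prop)
  · filter_upwards [MeasureTheory.ae_restrict_mem measurableSet_Ioi] with s hs
    exact norm_rotated_airyKernel_le n hx (le_of_lt hs)

/-- The oscillatory integral of the Airy kernel converges to the absolutely convergent integral
along the ray of argument `π / 6`. -/
lemma tendsto_integral_airyKernel {n : ℕ} (hn : n ≤ 1) {x : ℝ} (hx : |x| ≤ 1) :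
    Tendsto (fun R : ℝ => ∫ t in (0 : ℝ)..R, airyKernel n x t) atTop
      (nhds (∫ s in Set.Ioi (0 : ℝ), airyRay * airyKernel n x (airyRay * s))) := by
  have h1 := MeasureTheory.intervalIntegral_tendsto_integral_Ioi 0
    (integrableOn_rotated_airyKernel n hx) tendsto_id
  have h2 : Tendsto (fun R : ℝ => (∫ t in (0 : ℝ)..R, airyKernel n x t) -
      ∫ s in (0 : ℝ)..R, airyRay * airyKernel n x (airyRay * s)) atTop (nhds 0) := by
    refine squeeze_zero_norm' ?_ (tendsto_const_nhds.div_atTop tendsto_id : Tendsto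
      (fun R : ℝ => 4 / R) atTop (nhds 0))
    filter_upwards [eventually_ge_atTop 2] with R hR
    have := integral_sub_integral_rotated (differentiable_airyKernel n x) R (Real.pi / 6)
    unfold airyRay
    rw [this, norm_neg]
    exact norm_arc_integral_airyKernel_le hn hx hR
  simpa using h2.add h1

lemma tendsto_integral_airyKernel_im {n : ℕ} (hn : n ≤ 1) {x : ℝ} (hx : |x| ≤ 1) :
    Tendsto (fun R : ℝ => ∫ t in (0 : ℝ)..R, t ^ n * Real.sin (x * t + t ^ 3 / 3)) atTop
      (nhds (∫ s in Set.Ioi (0 : ℝ), airyRay * airyKernel n x (airyRay * s)).im) := by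
  refine ((Complex.continuous_im.tendsto _).comp (tendsto_integral_airyKernel hn hx)).congr
    fun R => ?_
  have hc := (differentiable_airyKernel n x).continuous
  have h := Complex.imCLM.intervalIntegral_comp_comm (a := 0) (b := R)
    (f := fun t : ℝ => airyKernel n x t) (μ := MeasureTheory.volume)
    (Continuous.intervalIntegrable (by fun_prop) _ _)
  simp only [Complex.imCLM_apply] at h
  simp only [Function.comp_apply]
  rw [← h]
  congr 1
  ext t
  have : airyKernel n x t =
      ((t ^ n : ℝ) : ℂ) * Complex.exp ((x * t + t ^ 3 / 3 : ℝ) * Complex.I) := by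
    simp only [airyKernel]
    push_cast
    ring_nf
  rw [this, Complex.im_ofReal_mul, Complex.exp_ofReal_mul_I_im]

lemma tendsto_integral_airyKernel_re {n : ℕ} (hn : n ≤ 1) {x : ℝ} (hx : |x| ≤ 1) :
    Tendsto (fun R : ℝ => ∫ t in (0 : ℝ)..R, t ^ n * Real.cos (x * t + t ^ 3 / 3)) atTop
      (nhds (∫ s in Set.Ioi (0 : ℝ), airyRay * airyKernel n x (airyRay * s)).re) := by
  refine ((Complex.continuous_re.tendsto _).comp (tendsto_integral_airyKernel hn hx)).congr
    fun R => ?_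
  have hc := (differentiable_airyKernel n x).continuous
  have h := Complex.reCLM.intervalIntegral_comp_comm (a := 0) (b := R)
    (f := fun t : ℝ => airyKernel n x t) (μ := MeasureTheory.volume)
    (Continuous.intervalIntegrable (by fun_prop) _ _)
  simp only [Complex.reCLM_apply] at h
  simp only [Function.comp_apply]
  rw [← h]
  congr 1
  ext t
  have : airyKernel n x t =
      ((t ^ n : ℝ) : ℂ) * Complex.exp ((x * t + t ^ 3 / 3 : ℝ) * Complex.I) := by
    simp only [airyKernel]
    push_cast
    ring_nf
  rw [this, Complex.re_ofReal_mul, Complex.exp_ofReal_mul_I_re]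

lemma hasDerivAt_airyKernel_parameter (n : ℕ) (x : ℝ) (z : ℂ) :
    HasDerivAt (fun y : ℝ => airyKernel n y z) (Complex.I * airyKernel (n + 1) x z) x := by
  have h0 : HasDerivAt (fun y : ℝ => Complex.I * ((y : ℂ) * z + z ^ 3 / 3)) (Complex.I * z) x := by
    simpa using (((Complex.ofRealCLM.hasDerivAt (x := x)).mul_const z).add_const
      (z ^ 3 / 3)).const_mul Complex.I
  refine (h0.cexp.const_mul (z ^ n)).congr_deriv ?_
  rw [airyKernel]
  ring

lemma hasDerivAt_integral_rotated_airyKernel :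
    HasDerivAt (fun x : ℝ => ∫ s in Set.Ioi (0 : ℝ), airyRay * airyKernel 0 x (airyRay * s))
      (Complex.I * ∫ s in Set.Ioi (0 : ℝ), airyRay * airyKernel 1 0 (airyRay * s)) 0 := by
  have hc : ∀ n x, Continuous (airyKernel n x) :=
    fun n x => (differentiable_airyKernel n x).continuous
  have h := hasDerivAt_integral_of_dominated_loc_of_deriv_le
    (μ := MeasureTheory.volume.restrict (Set.Ioi (0 : ℝ))) (x₀ := (0 : ℝ))
    (F := fun (x s : ℝ) => airyRay * airyKernel 0 x (airyRay * s))
    (F' := fun (x s : ℝ) => Complex.I * (airyRay * airyKernel 1 x (airyRay * s)))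
    (bound := fun s => s ^ 1 * Real.exp (2 - s))
    (Metric.ball_mem_nhds 0 one_pos)
    (Eventually.of_forall fun x => by
      have := hc 0 x
      exact Continuous.aestronglyMeasurable (by fun_prop))
    (integrableOn_rotated_airyKernel 0 (by simp))
    (by
      have := hc 1 0
      exact Continuous.aestronglyMeasurable (by fun_prop))
    (by
      filter_upwards [MeasureTheory.ae_restrict_mem measurableSet_Ioi] with s hs x hx
      rw [norm_mul, Complex.norm_I, one_mul]
      refine norm_rotated_airyKernel_le 1 ?_ (le_of_lt hs)
      simpa using (mem_ball_zero_iff.mp hx).le)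
    (integrableOn_pow_mul_exp_two_sub 1)
    (Eventually.of_forall fun s x _ => by
      exact ((hasDerivAt_airyKernel_parameter 0 x (airyRay * s)).const_mul airyRay).congr_deriv
        (mul_left_comm _ _ _))
  rw [← MeasureTheory.integral_const_mul]
  exact h.2

lemma integral_mul_exp_neg_cube_div_three :
    ∫ s in Set.Ioi (0 : ℝ), s * Real.exp (-(s ^ 3 / 3)) =
      2 * (Real.pi / ((3 : ℝ) ^ ((5 : ℝ) / 6) * Real.Gamma (1 / 3))) := by
  have h := integral_rpow_mul_exp_neg_mul_rpow (p := 3) (q := 1) (b := 1 / 3)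
    (by norm_num) (by norm_num) (by norm_num)
  have h' : ∫ s in Set.Ioi (0 : ℝ), s * Real.exp (-(s ^ 3 / 3)) =
      ∫ s in Set.Ioi (0 : ℝ), s ^ (1 : ℝ) * Real.exp (-(1 / 3) * s ^ (3 : ℝ)) := by
    congr 1
    ext s
    rw [Real.rpow_one, show (3 : ℝ) = ((3 : ℕ) : ℝ) by norm_num, Real.rpow_natCast]
    push_cast
    ring_nf
  have hG := Real.Gamma_mul_Gamma_one_sub (1 / 3)
  rw [show Real.pi * (1 / 3) = Real.pi / 3 by ring, Real.sin_pi_div_three,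
    show (1 : ℝ) - 1 / 3 = 2 / 3 by norm_num] at hG
  have hpos : 0 < Real.Gamma (1 / 3) := Real.Gamma_pos_of_pos (by norm_num)
  have h3 : (3 : ℝ) ^ ((5 : ℝ) / 6) = 3 ^ ((1 : ℝ) / 3) * √3 := by
    rw [Real.sqrt_eq_rpow, ← Real.rpow_add (by norm_num)]
    norm_num
  have hb : (1 / 3 : ℝ) ^ (-(1 + 1) / 3 : ℝ) * (1 / 3) * 3 ^ ((1 : ℝ) / 3) = 1 := by
    rw [one_div, Real.inv_rpow (by norm_num), ← Real.rpow_neg (by norm_num), mul_right_comm,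
      ← Real.rpow_add (by norm_num)]
    norm_num
  rw [h', h, h3, show ((1 : ℝ) + 1) / 3 = 2 / 3 by norm_num]
  have hG2 : Real.Gamma (2 / 3) * Real.Gamma (1 / 3) * √3 = 2 * Real.pi := by
    rw [mul_comm (Real.Gamma (2 / 3)), hG]
    field_simp
  rw [← mul_div_assoc 2, eq_div_iff (by positivity)]
  linear_combination (Real.Gamma (2 / 3) * Real.Gamma (1 / 3) * √3) * hb + hG2

lemma integral_rotated_airyKernel_one_zero_re :
    (∫ s in Set.Ioi (0 : ℝ), airyRay * airyKernel 1 0 (airyRay * s)).re =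
      Real.pi / ((3 : ℝ) ^ ((5 : ℝ) / 6) * Real.Gamma (1 / 3)) := by
  have h : ∫ s in Set.Ioi (0 : ℝ), airyRay * airyKernel 1 0 (airyRay * s) =
      airyRay ^ 2 * ((∫ s in Set.Ioi (0 : ℝ), s * Real.exp (-(s ^ 3 / 3)) : ℝ) : ℂ) := by
    rw [← integral_complex_ofReal, ← MeasureTheory.integral_const_mul]
    congr 1
    ext s
    rw [rotated_airyKernel]
    push_cast
    ring_nf
  have h2 : (airyRay ^ 2).re = 1 / 2 := by
    have h3 : √3 * √3 = 3 := Real.mul_self_sqrt (by norm_num)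
    rw [airyRay_eq, pow_two]
    simp
    nlinarith
  rw [h, Complex.re_mul_ofReal, h2, integral_mul_exp_neg_cube_div_three]
  ring

theorem scorer_Gi_deriv_zero (Gi : ℝ → ℝ)
    (hGi : ∀ x : ℝ, Tendsto (fun R : ℝ => ∫ t in (0 : ℝ)..R, Real.sin (x * t + t ^ 3 / 3))
      atTop (nhds (Real.pi * Gi x))) :
    deriv Gi 0 = 1 / ((3 : ℝ) ^ ((5 : ℝ) / 6) * Real.Gamma (1 / 3)) ∧
      Tendsto (fun R : ℝ => ∫ t in (0 : ℝ)..R, t * Real.cos (t ^ 3 / 3)) atTop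
        (nhds (Real.pi / ((3 : ℝ) ^ ((5 : ℝ) / 6) * Real.Gamma (1 / 3)))) := by
  constructor
  · have hd := (Complex.imCLM.hasFDerivAt.comp_hasDerivAt (0 : ℝ)
      hasDerivAt_integral_rotated_airyKernel).const_mul Real.pi⁻¹
    have heq : Gi =ᶠ[nhds 0] fun x => Real.pi⁻¹ *
        (∫ s in Set.Ioi (0 : ℝ), airyRay * airyKernel 0 x (airyRay * s)).im := by
      filter_upwards [Metric.ball_mem_nhds (0 : ℝ) one_pos] with x hx
      have hx' : |x| ≤ 1 := by simpa using (mem_ball_zero_iff.mp hx).le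
      have h := tendsto_integral_airyKernel_im (n := 0) (by norm_num) hx'
      simp only [pow_zero, one_mul] at h
      rw [← tendsto_nhds_unique (hGi x) h]
      field_simp
    rw [heq.deriv_eq]
    refine HasDerivAt.deriv (hd.congr_deriv ?_)
    rw [Complex.imCLM_apply, Complex.I_mul_im, integral_rotated_airyKernel_one_zero_re]
    field_simp
  · have h := tendsto_integral_airyKernel_re (n := 1) (x := 0) le_rfl (by simp)
    rw [integral_rotated_airyKernel_one_zero_re] at h
    simpa using h
end

section
/- For every real number x, the Scorer functions satisfy the connection formula Gi(x) = −(1/2) · [ exp(2πi/3) · Hi(x · exp(2πi/3)) + exp(−2πi/3) · Hi(x · exp(−2πi/3)) ], where on the left Gi(x) is regarded as a complex number. -/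
open Filter MeasureTheory Set Complex

/-- The integral of a continuous complex function along a segment is the difference of the values
of a primitive at the endpoints. -/
lemma mul_integral_segment_eq_sub {f F : ℂ → ℂ} (hF : ∀ z, HasDerivAt F (f z) z)
    (hf : Continuous f) (a v : ℂ) (b : ℝ) :
    v * ∫ t in (0 : ℝ)..b, f (a + v * t) = F (a + v * b) - F a := by
  rw [← intervalIntegral.integral_const_mul]
  have h : ∀ t ∈ uIcc (0 : ℝ) b,
      HasDerivAt (fun t : ℝ => F (a + v * t)) (v * f (a + v * t)) t := by
    intro t _
    have h1 : HasDerivAt (fun t : ℝ => a + v * (t : ℂ)) v t := by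
      simpa using ((Complex.ofRealCLM.hasDerivAt (x := t)).const_mul v).const_add a
    have h2 := (hF (a + v * t)).comp t h1
    rwa [mul_comm] at h2
  rw [intervalIntegral.integral_eq_sub_of_hasDerivAt h]
  · simp
  · exact Continuous.intervalIntegrable (by fun_prop) _ _

lemma integrableOn_Hi_integrand (z : ℂ) :
    IntegrableOn (fun t : ℝ => Complex.exp (z * t - (t : ℂ) ^ 3 / 3)) (Ioi 0) := by
  have hre : ∀ t : ℝ, (z * t - (t : ℂ) ^ 3 / 3).re = z.re * t - t ^ 3 / 3 := by
    intro t
    have : (t : ℂ) ^ 3 / 3 = ((t ^ 3 / 3 : ℝ) : ℂ) := by push_cast; ring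
    rw [this, Complex.sub_re, Complex.ofReal_re, Complex.re_mul_ofReal]
  have hreal : IntegrableOn (fun t : ℝ => Real.exp (z.re * t - t ^ 3 / 3)) (Ioi 0) := by
    refine integrable_of_isBigO_exp_neg one_pos (by fun_prop) ?_
    refine Asymptotics.IsBigO.of_bound 1 ?_
    filter_upwards [eventually_ge_atTop (3 + |z.re|)] with t ht
    rw [Real.norm_of_nonneg (Real.exp_nonneg _), Real.norm_of_nonneg (Real.exp_nonneg _), one_mul]
    refine Real.exp_le_exp.2 ?_
    have h1 := le_abs_self z.re
    have h0 := abs_nonneg z.re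
    have ht0 : 0 ≤ t := by linarith
    have h2 : 0 ≤ t ^ 2 / 3 - z.re - 1 := by nlinarith
    nlinarith [mul_nonneg ht0 h2]
  refine hreal.mono' (Continuous.aestronglyMeasurable (by fun_prop)) ?_
  filter_upwards with t
  rw [Complex.norm_exp, hre]

lemma Hi_conj (z : ℂ) : Hi (starRingEnd ℂ z) = starRingEnd ℂ (Hi z) := by
  simp only [Hi, map_mul, map_div₀, map_one, Complex.conj_ofReal, ← integral_conj,
    ← Complex.exp_conj, map_sub, map_pow, map_ofNat]

lemma integral_exp_neg_mul_le_inv {R : ℝ} (hR : 0 < R) (b : ℝ) :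
    ∫ y in (0 : ℝ)..b, Real.exp (-R * y) ≤ R⁻¹ := by
  have h : ∀ y ∈ uIcc (0 : ℝ) b,
      HasDerivAt (fun y : ℝ => -R⁻¹ * Real.exp (-R * y)) (Real.exp (-R * y)) y := by
    intro y _
    have h1 := (((hasDerivAt_id y).const_mul (-R)).exp).const_mul (-R⁻¹)
    convert! h1 using 1
    simp only [id]
    field_simp
  rw [intervalIntegral.integral_eq_sub_of_hasDerivAt h
    (Continuous.intervalIntegrable (by fun_prop) _ _)]
  have : 0 < R⁻¹ * Real.exp (-R * b) := by positivity
  simp only [mul_zero, Real.exp_zero]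
  linarith

/-- The integral of the Airy exponential over the horizontal segment joining the imaginary axis to
the ray of argument `2π/3` is small. -/
lemma norm_integral_airyExp_segment_le (x : ℝ) {R b : ℝ} (hR : 3 + |x| ≤ R) (hb : 0 ≤ b)
    (hbR : b ≤ R) :
    ‖∫ y in (0 : ℝ)..b, Complex.exp (x * (I * R + -1 * y) - (I * R + -1 * y) ^ 3 / 3)‖ ≤ R⁻¹ := by
  have h0 := abs_nonneg x
  have hx := neg_abs_le x
  refine le_trans (intervalIntegral.norm_integral_le_of_norm_le hb (.of_forall fun y hy => ?_)
    (Continuous.intervalIntegrable (u := fun y => Real.exp (-R * y)) (by fun_prop) _ _))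
    (integral_exp_neg_mul_le_inv (by linarith) b)
  rw [Complex.norm_exp]
  refine Real.exp_le_exp.2 ?_
  have hre : (x * (I * R + -1 * y) - (I * R + -1 * y) ^ 3 / 3 : ℂ)
      = ((-x * y + y ^ 3 / 3 - y * R ^ 2 : ℝ) : ℂ) +
        ((x * R + R ^ 3 / 3 - y ^ 2 * R : ℝ) : ℂ) * I := by
    push_cast
    linear_combination ((R : ℂ) ^ 2 * y - R ^ 3 * I / 3) * Complex.I_sq
  rw [hre, Complex.add_re, Complex.ofReal_re, Complex.re_ofReal_mul, Complex.I_re]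
  have hy0 : 0 ≤ y := hy.1.le
  have hyR : y ≤ R := hy.2.trans hbR
  have h2 : 0 ≤ 2 / 3 * R ^ 2 + x - R := by nlinarith
  have h3 : y ^ 2 ≤ R ^ 2 := by gcongr
  nlinarith [mul_nonneg hy0 h2, mul_nonneg hy0 (sub_nonneg.2 h3)]

lemma exp_two_pi_I_div_three :
    Complex.exp (2 * Real.pi * I / 3) = -1 / 2 + ((√3 / 2 : ℝ) : ℂ) * I := by
  have h : (2 * Real.pi * I / 3 : ℂ) = ((Real.pi - Real.pi / 3 : ℝ) : ℂ) * I := by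
    push_cast; ring
  rw [h, Complex.exp_mul_I, ← Complex.ofReal_cos, ← Complex.ofReal_sin, Real.cos_pi_sub,
    Real.sin_pi_sub, Real.cos_pi_div_three, Real.sin_pi_div_three]
  push_cast; ring

lemma exp_two_pi_I_div_three_pow_three : Complex.exp (2 * Real.pi * I / 3) ^ 3 = 1 := by
  rw [← Complex.exp_nat_mul, ← Complex.exp_two_pi_mul_I]
  congr 1
  push_cast; ring

/-- The integrals of the Airy exponential along the ray of argument `2π/3` and along the imaginary
axis agree asymptotically. -/
lemma tendsto_airyExp_ray_sub_imaginary (x : ℝ) :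
    Tendsto (fun R : ℝ =>
      Complex.exp (2 * Real.pi * I / 3) * (∫ t in (0 : ℝ)..(2 / √3 * R),
        Complex.exp (x * Complex.exp (2 * Real.pi * I / 3) * t - (t : ℂ) ^ 3 / 3)) -
      I * ∫ t in (0 : ℝ)..R, Complex.exp (((x * t + t ^ 3 / 3 : ℝ) : ℂ) * I))
      atTop (nhds 0) := by
  set w := Complex.exp (2 * Real.pi * I / 3) with hw
  set f : ℂ → ℂ := fun u => Complex.exp (x * u - u ^ 3 / 3) with hf
  have hfd : Differentiable ℂ f := by fun_prop
  obtain ⟨F, hF⟩ := hfd.isExactOn_univ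
  have hseg := mul_integral_segment_eq_sub (fun z => hF z (mem_univ z)) hfd.continuous
  refine squeeze_zero_norm' ?_ tendsto_inv_atTop_zero
  filter_upwards [eventually_ge_atTop (3 + |x|)] with R hR
  have hs3 : (1 : ℝ) ≤ √3 := Real.one_le_sqrt.2 (by norm_num)
  have hsq : √3 ^ 2 = 3 := Real.sq_sqrt (by norm_num)
  have hR0 : 0 ≤ R := by linarith [abs_nonneg x]
  have h1 := hseg 0 w (2 / √3 * R)
  have h2 := hseg 0 I R
  have h3 := hseg (I * R) (-1) (R / √3)
  have hend : (0 : ℂ) + w * ((2 / √3 * R : ℝ) : ℂ) = I * R + -1 * ((R / √3 : ℝ) : ℂ) := by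
    have : (√3 : ℂ) ≠ 0 := by
      exact_mod_cast (by positivity : √3 ≠ 0)
    rw [hw, exp_two_pi_I_div_three]
    push_cast
    field_simp
    ring
  have e1 : ∀ t : ℝ, f (0 + w * t) = Complex.exp (x * w * t - (t : ℂ) ^ 3 / 3) := by
    intro t
    simp only [hf, zero_add, mul_pow, exp_two_pi_I_div_three_pow_three, hw]
    congr 1; ring
  have e2 : ∀ t : ℝ, f (0 + I * t) = Complex.exp (((x * t + t ^ 3 / 3 : ℝ) : ℂ) * I) := by
    intro t
    simp only [hf, zero_add, mul_pow, Complex.I_pow_three]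
    congr 1; push_cast; ring
  simp only [e1] at h1
  simp only [e2] at h2
  rw [h1, h2, hend, zero_add, sub_sub_sub_cancel_right, ← h3, norm_mul, norm_neg, norm_one, one_mul]
  exact norm_integral_airyExp_segment_le x hR (by positivity) (div_le_self hR0 hs3)

theorem scorer_Gi_Hi_connection (Gi : ℝ → ℝ)
    (hGi : ∀ x : ℝ, Tendsto (fun R : ℝ => ∫ t in (0 : ℝ)..R, Real.sin (x * t + t ^ 3 / 3))
      atTop (nhds (Real.pi * Gi x))) :
    ∀ x : ℝ, (Gi x : ℂ) =
      -(1 / 2) * (Complex.exp (2 * Real.pi * I / 3) * Hi (x * Complex.exp (2 * Real.pi * I / 3)) +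
        Complex.exp (-(2 * Real.pi * I) / 3) * Hi (x * Complex.exp (-(2 * Real.pi * I) / 3))) := by
  intro x
  have hconj : Complex.exp (-(2 * Real.pi * I) / 3)
      = starRingEnd ℂ (Complex.exp (2 * Real.pi * I / 3)) := by
    rw [← Complex.exp_conj]
    congr 1
    simp only [map_div₀, map_mul, map_ofNat, Complex.conj_ofReal, Complex.conj_I]
    ring
  have hdiff := tendsto_airyExp_ray_sub_imaginary x
  rw [hconj]
  set w := Complex.exp (2 * Real.pi * I / 3) with hw
  have hxw : (x : ℂ) * starRingEnd ℂ w = starRingEnd ℂ (x * w) := by simp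
  rw [hxw, Hi_conj, ← map_mul, Complex.add_conj]
  have hray := (intervalIntegral_tendsto_integral_Ioi 0 (integrableOn_Hi_integrand (x * w))
    (tendsto_id.const_mul_atTop (by positivity : (0 : ℝ) < 2 / √3))).const_mul w
  have hre := (Complex.continuous_re.tendsto _).comp (hray.sub hdiff)
  have him : ∀ R : ℝ,
      (I * ∫ t in (0 : ℝ)..R, Complex.exp (((x * t + t ^ 3 / 3 : ℝ) : ℂ) * I)).re
        = -∫ t in (0 : ℝ)..R, Real.sin (x * t + t ^ 3 / 3) := by
    intro R
    rw [Complex.I_mul_re, ← Complex.imCLM_apply, ← ContinuousLinearMap.intervalIntegral_comp_comm]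
    · simp only [Complex.imCLM_apply, Complex.exp_ofReal_mul_I_im]
    · exact Continuous.intervalIntegrable (by fun_prop) _ _
  have hlim := tendsto_nhds_unique (hre.congr fun R => by
    simp only [Function.comp_apply, id, sub_sub_cancel]
    exact him R) (hGi x).neg
  have hHi : w * ∫ t in Ioi (0 : ℝ), Complex.exp (x * w * t - (t : ℂ) ^ 3 / 3)
      = Real.pi * (w * Hi (x * w)) := by
    have : (Real.pi : ℂ) ≠ 0 := by exact_mod_cast Real.pi_ne_zero
    rw [Hi]
    field_simp
  rw [sub_zero, hHi, Complex.re_ofReal_mul, ← mul_neg] at hlim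
  rw [mul_left_cancel₀ Real.pi_ne_zero hlim]
  push_cast
  ring
end

section
/- Let x < 0, y ≥ 0 be real numbers with 3x² ≥ y², and let u ≥ 0. Set P = (3/2) y u and Q = u² − x. Then Q > 0 and 0 ≤ P ≤ Q^{3/2}; in particular P/Q^{3/2} lies in [0, 1]. -/
theorem scorer_path_PQ_bounds (x y u : ℝ) (hx : x < 0) (hy : 0 ≤ y)
    (hxy : y ^ 2 ≤ 3 * x ^ 2) (hu : 0 ≤ u) :
    0 < u ^ 2 - x ∧ 0 ≤ (3 / 2) * y * u ∧
      (3 / 2) * y * u ≤ (u ^ 2 - x) ^ ((3 : ℝ) / 2) := by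
  have hQ : 0 < u ^ 2 - x := by nlinarith [sq_nonneg u]
  refine ⟨hQ, by positivity, ?_⟩
  have hpow : ((u ^ 2 - x) ^ ((3 : ℝ) / 2)) ^ 2 = (u ^ 2 - x) ^ 3 := by
    rw [← Real.rpow_mul_natCast hQ.le, ← Real.rpow_natCast]
    norm_num
  refine le_of_pow_le_pow_left₀ two_ne_zero (Real.rpow_nonneg hQ.le _) ?_
  rw [hpow]
  have hcubic : 0 ≤ (u ^ 2 + x / 2) ^ 2 * (u ^ 2 - 4 * x) :=
    mul_nonneg (sq_nonneg _) (by nlinarith [sq_nonneg u])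
  have hmul : y ^ 2 * u ^ 2 ≤ 3 * x ^ 2 * u ^ 2 := by gcongr
  linear_combination hcubic + 9 / 4 * hmul
end

section
/- Let x < 0, y ≥ 0 be real numbers with 3x² > y², and let u ≥ 0. Set P = (3/2) y u, Q = u² − x, θ = arcsin(P/Q^{3/2}) and v = 2 √Q · sin(θ/3). Then v satisfies the cubic equation u² v − v³/3 − x v − y u = 0. -/
theorem scorer_path_cubic_solution (x y u : ℝ) (hx : x < 0) (hy : 0 ≤ y)
    (hxy : y ^ 2 < 3 * x ^ 2) (hu : 0 ≤ u) :
    ∀ v : ℝ,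
      v = 2 * Real.sqrt (u ^ 2 - x) *
        Real.sin (Real.arcsin ((3 / 2) * y * u / (u ^ 2 - x) ^ ((3 : ℝ) / 2)) / 3) →
      u ^ 2 * v - v ^ 3 / 3 - x * v - y * u = 0 := by
  intro v hv
  have hQ : 0 < u ^ 2 - x := by nlinarith [sq_nonneg u]
  have hs : 0 < Real.sqrt (u ^ 2 - x) := Real.sqrt_pos.mpr hQ
  have hs2 : Real.sqrt (u ^ 2 - x) ^ 2 = u ^ 2 - x := Real.sq_sqrt hQ.le
  have hpow : (u ^ 2 - x) ^ ((3 : ℝ) / 2) = Real.sqrt (u ^ 2 - x) ^ 3 := by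
    rw [Real.sqrt_eq_rpow, ← Real.rpow_mul_natCast hQ.le]
    norm_num
  rw [hpow] at hv
  generalize Real.sqrt (u ^ 2 - x) = s at hs hs2 hv
  have hPs : (3 / 2) * y * u ≤ s ^ 3 := by
    refine (sq_le_sq₀ (by positivity) (by positivity)).mp ?_
    have hs6 : (s ^ 3) ^ 2 = (u ^ 2 - x) ^ 3 := by rw [← hs2]; ring
    have hamgm : 0 ≤ (u ^ 2 - 4 * x) * (u ^ 2 + x / 2) ^ 2 :=
      mul_nonneg (by nlinarith [sq_nonneg u]) (sq_nonneg _)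
    rw [hs6]
    nlinarith [mul_le_mul_of_nonneg_right hxy.le (sq_nonneg u)]
  have hsin : Real.sin (Real.arcsin ((3 / 2) * y * u / s ^ 3)) = (3 / 2) * y * u / s ^ 3 :=
    Real.sin_arcsin (by linarith [show 0 ≤ (3 / 2) * y * u / s ^ 3 by positivity])
      ((div_le_one (by positivity)).mpr hPs)
  generalize Real.arcsin ((3 / 2) * y * u / s ^ 3) = θ at hsin hv
  have htriple := Real.sin_three_mul (θ / 3)
  rw [show 3 * (θ / 3) = θ by ring, hsin, div_eq_iff (by positivity)] at htriple
  subst hv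
  linear_combination (-2 * s * Real.sin (θ / 3)) * hs2 - (2 / 3) * htriple
end

section
/- Let x < 0 ≤ y be real numbers with 3x² > y², and let z = x + i y. For u ≥ 0 define Q(u) = u² − x, P(u) = (3/2) y u, θ(u) = arcsin(P(u)/Q(u)^{3/2}), v(u) = 2 √(Q(u)) · sin(θ(u)/3), φ_r(u) = u³/3 − u·v(u)² − x u + y·v(u), and h(u) = 1 + i·(2 u v(u) − y)/(v(u)² − u² + x). Then Hi(z) = (1/π) ∫₀^∞ exp(−φ_r(u)) · h(u) du, where the integral is a Lebesgue integral of a complex-valued function over (0, ∞). -/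
open MeasureTheory Set

/-- The steepest-descent path `v(u)` for `Hi` in the sector `2π/3 ≤ ph z ≤ π`. -/
noncomputable def V (x y u : ℝ) : ℝ :=
  2 * Real.sqrt (u ^ 2 - x) *
    Real.sin (Real.arcsin ((3 / 2) * y * u / (u ^ 2 - x) ^ ((3 : ℝ) / 2)) / 3)

open Filter Topology

/-- The radicand inequality making the argument of `arcsin` in `V` lie in `(-1, 1)`. -/
lemma sq_arcsin_arg_lt (x y : ℝ) (hx : x < 0) (hxy : y ^ 2 < 3 * x ^ 2) (u : ℝ) :
    ((3 / 2) * y * u) ^ 2 < (u ^ 2 - x) ^ 3 := by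
  obtain ⟨a, rfl⟩ : ∃ a, x = -a := ⟨-x, by ring⟩
  have ha : 0 < a := by linarith
  rcases eq_or_ne u 0 with rfl | hu
  · simp only [mul_zero]; ring_nf; positivity
  have hu2 : 0 < u ^ 2 := by positivity
  have h1 : y ^ 2 * u ^ 2 < 3 * (-a) ^ 2 * u ^ 2 := mul_lt_mul_of_pos_right hxy hu2
  have h2 : 0 ≤ (2 * u ^ 2 - a) ^ 2 * (u ^ 2 + 4 * a) := by positivity
  nlinarith

lemma sqrt_pow_three_eq_rpow {q : ℝ} (hq : 0 < q) : √q ^ 3 = q ^ ((3 : ℝ) / 2) := by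
  rw [Real.sqrt_eq_rpow, ← Real.rpow_natCast, ← Real.rpow_mul hq.le]
  norm_num

lemma abs_arcsin_arg_lt_one (x y : ℝ) (hx : x < 0) (hxy : y ^ 2 < 3 * x ^ 2) (u : ℝ) :
    |(3 / 2) * y * u / (u ^ 2 - x) ^ ((3 : ℝ) / 2)| < 1 := by
  have hQ : 0 < u ^ 2 - x := by nlinarith [sq_nonneg u]
  rw [← sqrt_pow_three_eq_rpow hQ, ← sq_lt_one_iff_abs_lt_one, div_pow, div_lt_one (by positivity),
    ← pow_mul, mul_comm 3 2, pow_mul, Real.sq_sqrt hQ.le]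
  exact sq_arcsin_arg_lt x y hx hxy u

/-- The imaginary part of the phase vanishes along the path. -/
lemma V_cubic (x y : ℝ) (hx : x < 0) (hxy : y ^ 2 < 3 * x ^ 2) (u : ℝ) :
    V x y u ^ 3 - 3 * (u ^ 2 - x) * V x y u + 3 * y * u = 0 := by
  have hQ : 0 < u ^ 2 - x := by nlinarith [sq_nonneg u]
  have hs := Real.sq_sqrt hQ.le
  have hs0 := Real.sqrt_pos.2 hQ
  have h := abs_lt.1 (abs_arcsin_arg_lt_one x y hx hxy u)
  have h3 := Real.sin_three_mul
    (Real.arcsin ((3 / 2) * y * u / (u ^ 2 - x) ^ ((3 : ℝ) / 2)) / 3)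
  rw [mul_div_cancel₀ _ (by norm_num : (3 : ℝ) ≠ 0), Real.sin_arcsin h.1.le h.2.le,
    ← sqrt_pow_three_eq_rpow hQ, div_eq_iff (by positivity)] at h3
  unfold V
  rw [← sqrt_pow_three_eq_rpow hQ]
  set s := √(u ^ 2 - x)
  rw [← hs]
  linear_combination 2 * h3

lemma V_sq_lt (x y : ℝ) (hx : x < 0) (hxy : y ^ 2 < 3 * x ^ 2) (u : ℝ) :
    V x y u ^ 2 < u ^ 2 - x := by
  have hQ : 0 < u ^ 2 - x := by nlinarith [sq_nonneg u]
  have h := abs_lt.1 (abs_arcsin_arg_lt_one x y hx hxy u)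
  unfold V
  set a := (3 / 2) * y * u / (u ^ 2 - x) ^ ((3 : ℝ) / 2)
  have h1 : Real.arcsin a < Real.pi / 2 := Real.arcsin_lt_pi_div_two.2 h.2
  have h2 : -(Real.pi / 2) < Real.arcsin a := Real.neg_pi_div_two_lt_arcsin.2 h.1
  have hpi := Real.pi_pos
  have h3 : Real.sin (Real.arcsin a / 3) < 1 / 2 := by
    rw [← Real.sin_pi_div_six]
    exact Real.sin_lt_sin_of_lt_of_le_pi_div_two (by linarith) (by linarith) (by linarith)
  have h4 : -(1 / 2) < Real.sin (Real.arcsin a / 3) := by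
    rw [← Real.sin_pi_div_six, ← Real.sin_neg]
    exact Real.sin_lt_sin_of_lt_of_le_pi_div_two (by linarith) (by linarith) (by linarith)
  rw [mul_pow, mul_pow, Real.sq_sqrt hQ.le]
  have h5 : Real.sin (Real.arcsin a / 3) ^ 2 < 1 / 4 := by nlinarith
  nlinarith

lemma V_nonneg (x y : ℝ) (hx : x < 0) (hy : 0 ≤ y) {u : ℝ} (hu : 0 ≤ u) : 0 ≤ V x y u := by
  have hQ : 0 < u ^ 2 - x := by nlinarith [sq_nonneg u]
  unfold V
  have h0 : 0 ≤ Real.arcsin ((3 / 2) * y * u / (u ^ 2 - x) ^ ((3 : ℝ) / 2)) :=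
    Real.arcsin_nonneg.2 (by positivity)
  have h1 := Real.arcsin_le_pi_div_two ((3 / 2) * y * u / (u ^ 2 - x) ^ ((3 : ℝ) / 2))
  have hpi := Real.pi_pos
  have := Real.sin_nonneg_of_nonneg_of_le_pi (div_nonneg h0 (by norm_num : (0 : ℝ) ≤ 3))
    (by linarith)
  positivity

lemma V_mul_le (x y : ℝ) (hx : x < 0) (hy : 0 ≤ y) (hxy : y ^ 2 < 3 * x ^ 2) {u : ℝ}
    (hu : 0 < u) : u * V x y u ≤ 3 / 2 * y := by
  have h0 := V_nonneg x y hx hy hu.le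
  have h1 := V_cubic x y hx hxy u
  have h2 := V_sq_lt x y hx hxy u
  have h3 : V x y u * V x y u ^ 2 ≤ V x y u * (u ^ 2 - x) := mul_le_mul_of_nonneg_left h2.le h0
  refine le_of_mul_le_mul_left ?_ hu
  nlinarith [mul_nonneg h0 (neg_nonneg.2 hx.le)]

lemma differentiableAt_V (x y : ℝ) (hx : x < 0) (hxy : y ^ 2 < 3 * x ^ 2) (u : ℝ) :
    DifferentiableAt ℝ (V x y) u := by
  have hQ : 0 < u ^ 2 - x := by nlinarith [sq_nonneg u]
  have h := abs_lt.1 (abs_arcsin_arg_lt_one x y hx hxy u)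
  unfold V
  have hp : DifferentiableAt ℝ
      (fun u : ℝ => (3 / 2) * y * u / (u ^ 2 - x) ^ ((3 : ℝ) / 2)) u := by
    refine DifferentiableAt.div (by fun_prop) ?_ (Real.rpow_pos_of_pos hQ _).ne'
    exact DifferentiableAt.rpow_const (by fun_prop) (Or.inl hQ.ne')
  have ha : DifferentiableAt ℝ
      (fun u : ℝ => Real.arcsin ((3 / 2) * y * u / (u ^ 2 - x) ^ ((3 : ℝ) / 2))) u :=
    DifferentiableAt.comp (g := Real.arcsin) u
      (Real.hasDerivAt_arcsin h.1.ne' h.2.ne).differentiableAt hp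
  have hs : DifferentiableAt ℝ (fun u : ℝ => √(u ^ 2 - x)) u :=
    DifferentiableAt.sqrt (by fun_prop) hQ.ne'
  exact (hs.const_mul 2).mul (ha.div_const 3).sin

lemma hasDerivAt_V (x y : ℝ) (hx : x < 0) (hxy : y ^ 2 < 3 * x ^ 2) (u : ℝ) :
    HasDerivAt (V x y) ((2 * u * V x y u - y) / (V x y u ^ 2 - u ^ 2 + x)) u := by
  have hd := (differentiableAt_V x y hx hxy u).hasDerivAt
  have hne : V x y u ^ 2 - u ^ 2 + x ≠ 0 := by
    have := V_sq_lt x y hx hxy u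
    linarith
  have hF : HasDerivAt
      (fun u => V x y u ^ 3 - 3 * (u ^ 2 - x) * V x y u + 3 * y * u) _ u :=
    ((hd.pow 3).sub (((((hasDerivAt_id u).pow 2).sub_const x).const_mul 3).mul hd)).add
      ((hasDerivAt_id u).const_mul (3 * y))
  have h0 := hF.unique ((hasDerivAt_const u (0 : ℝ)).congr_of_eventuallyEq
    (Eventually.of_forall fun u => V_cubic x y hx hxy u))
  have hd' : (2 * u * V x y u - y) / (V x y u ^ 2 - u ^ 2 + x) = deriv (V x y) u := by
    rw [div_eq_iff hne]
    simp at h0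
    linarith
  rwa [hd']

/-- Exponential decay of the integrand of `Hi` in a horizontal half-strip. -/
lemma norm_exp_scorer_le (x y M : ℝ) (hx : x < 0) (hy : 0 ≤ y) {u s : ℝ}
    (hu : 3 * (M ^ 2 + 1) ≤ u) (hs : 0 ≤ s) (hsM : s ≤ M) :
    ‖Complex.exp ((x + y * Complex.I) * (u + s * Complex.I)
      - (u + s * Complex.I) ^ 3 / 3)‖ ≤ Real.exp (-u) := by
  have hre : (x + y * Complex.I) * (u + s * Complex.I) - (u + s * Complex.I) ^ 3 / 3 =
      ((-(u ^ 3 / 3 - u * s ^ 2 - x * u + y * s) : ℝ) : ℂ) +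
        ((-(u ^ 2 * s - s ^ 3 / 3 - x * s - y * u) : ℝ) : ℂ) * Complex.I := by
    push_cast
    linear_combination (y * s - u * s ^ 2 - s ^ 3 * Complex.I / 3) * Complex.I_sq
  rw [Complex.norm_exp, hre]
  simp only [Complex.add_re, Complex.ofReal_re, Complex.mul_re, Complex.I_re, Complex.ofReal_im,
    Complex.I_im, mul_zero, zero_mul, sub_zero, add_zero]
  apply Real.exp_le_exp.2
  have hu1 : 1 ≤ u := by nlinarith [sq_nonneg M]
  have h1 : s ^ 2 ≤ M ^ 2 := by gcongr
  have h2 : u * s ^ 2 ≤ u * M ^ 2 := by gcongr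
  have h3 : 3 * (M ^ 2 + 1) * u ≤ u ^ 3 := by
    nlinarith [mul_le_mul_of_nonneg_right hu (by positivity : 0 ≤ u),
      mul_nonneg (sq_nonneg u) (sub_nonneg.2 hu1)]
  nlinarith [mul_nonneg hy hs, mul_nonneg (neg_nonneg.2 hx.le) (by positivity : 0 ≤ u)]

lemma integrableOn_Ioi_of_norm_le_exp_neg {f : ℝ → ℂ} (hf : Continuous f) (C U : ℝ)
    (h : ∀ u, U ≤ u → ‖f u‖ ≤ C * Real.exp (-u)) : IntegrableOn f (Ioi 0) := by
  refine IntegrableOn.mono_set ?_ Ioi_subset_Ici_self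
  refine (hf.continuousOn.locallyIntegrableOn measurableSet_Ici).integrableOn_of_isBigO_atTop
    (g := fun u => Real.exp (-1 * u)) ?_
    ⟨Ioi 1, Ioi_mem_atTop 1, exp_neg_integrableOn_Ioi 1 one_pos⟩
  refine Asymptotics.IsBigO.of_bound C ?_
  filter_upwards [eventually_ge_atTop U] with u hu
  simpa using h u hu

/-- Deforming the half-line `(0, ∞)` to a path staying in a half-strip of rapid decay. -/
lemma integral_Ioi_eq_integral_path {g : ℂ → ℂ} (hg : Differentiable ℂ g) {v d : ℝ → ℝ}
    (hv : ∀ u, HasDerivAt v (d u) u) (hv0 : v 0 = 0) (hd : Continuous d) {M D U : ℝ}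
    (hvM : ∀ u, U ≤ u → 0 ≤ v u ∧ v u ≤ M) (hdD : ∀ u, U ≤ u → |d u| ≤ D)
    (hgM : ∀ u s : ℝ, U ≤ u → 0 ≤ s → s ≤ M → ‖g (u + s * Complex.I)‖ ≤ Real.exp (-u)) :
    ∫ t in Ioi (0 : ℝ), g t =
      ∫ u in Ioi (0 : ℝ), g (u + v u * Complex.I) * (1 + Complex.I * d u) := by
  obtain ⟨G, hG⟩ := hg.isExactOn_univ
  have hvc : Continuous v := continuous_iff_continuousAt.2 fun u => (hv u).continuousAt
  have hM : 0 ≤ M := (hvM U le_rfl).1.trans (hvM U le_rfl).2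
  have hgc := hg.continuous
  have hint : IntegrableOn (fun t : ℝ => g t) (Ioi 0) := by
    refine integrableOn_Ioi_of_norm_le_exp_neg (by fun_prop) 1 U fun u hu => ?_
    simpa using hgM u 0 hu le_rfl hM
  have hint' : IntegrableOn (fun u : ℝ => g (u + v u * Complex.I) * (1 + Complex.I * d u))
      (Ioi 0) := by
    refine integrableOn_Ioi_of_norm_le_exp_neg (by fun_prop) (1 + D) U fun u hu => ?_
    have h1 := hgM u (v u) hu (hvM u hu).1 (hvM u hu).2
    have h2 : ‖1 + Complex.I * (d u : ℂ)‖ ≤ 1 + D := by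
      refine (norm_add_le _ _).trans ?_
      simpa using hdD u hu
    rw [norm_mul, mul_comm]
    exact mul_le_mul h2 h1 (norm_nonneg _) ((norm_nonneg _).trans h2)
  have hderiv : ∀ u : ℝ, HasDerivAt (fun t : ℝ => G t) (g u) u := fun u => by
    simpa using (hG (u : ℂ) (mem_univ _)).comp_ofReal
  have hderiv' : ∀ u : ℝ, HasDerivAt (fun u : ℝ => G (u + v u * Complex.I))
      (g (u + v u * Complex.I) * (1 + Complex.I * d u)) u := fun u => by
    have h1 : HasDerivAt (fun u : ℝ => (u : ℂ) + v u * Complex.I) (1 + d u * Complex.I) u :=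
      (hasDerivAt_id u).ofReal_comp.add ((hv u).ofReal_comp.mul_const _)
    rw [mul_comm Complex.I]
    exact (hG _ (mem_univ _)).comp u h1
  have hlim : Tendsto (fun t : ℝ => G t) atTop (𝓝 (G 0 + ∫ t in Ioi (0 : ℝ), g t)) := by
    refine ((intervalIntegral_tendsto_integral_Ioi 0 hint tendsto_id).const_add (G 0)).congr
      fun t => ?_
    rw [intervalIntegral.integral_eq_sub_of_hasDerivAt (fun u _ => hderiv u)
      ((by fun_prop : Continuous fun t : ℝ => g t).intervalIntegrable _ _)]
    simp
  have hdiff : Tendsto (fun u : ℝ => G (u + v u * Complex.I) - G u) atTop (𝓝 0) := by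
    refine squeeze_zero_norm' (a := fun u => Real.exp (-u) * M) ?_ ?_
    · filter_upwards [eventually_ge_atTop U] with u hu
      obtain ⟨hv1, hv2⟩ := hvM u hu
      have hseg : ∀ s ∈ Icc (0 : ℝ) M, HasDerivWithinAt (fun s : ℝ => G (u + s * Complex.I))
          (g (u + s * Complex.I) * Complex.I) (Icc 0 M) s := fun s _ => by
        have h1 : HasDerivAt (fun s : ℝ => (u : ℂ) + s * Complex.I) Complex.I s := by
          simpa using ((hasDerivAt_id s).ofReal_comp.mul_const Complex.I).const_add (u : ℂ)
        exact ((hG _ (mem_univ _)).comp s h1).hasDerivWithinAt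
      have hb := Convex.norm_image_sub_le_of_norm_hasDerivWithin_le hseg
        (C := Real.exp (-u)) (fun s hs => by simpa using hgM u s hu hs.1 hs.2) (convex_Icc 0 M)
        ⟨le_rfl, hM⟩ ⟨hv1, hv2⟩
      simp only [Complex.ofReal_zero, zero_mul, add_zero, sub_zero, Real.norm_eq_abs,
        abs_of_nonneg hv1] at hb
      exact hb.trans (by gcongr)
    · simpa using Real.tendsto_exp_neg_atTop_nhds_zero.mul_const M
  have hlim' := hdiff.add hlim
  simp only [sub_add_cancel, zero_add] at hlim'
  rw [integral_Ioi_of_hasDerivAt_of_tendsto' (fun u _ => hderiv' u) hint' hlim']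
  simp [hv0]

theorem scorer_Hi_nonoscillating_integral (x y : ℝ) (hx : x < 0) (hy : 0 ≤ y)
    (hxy : y ^ 2 < 3 * x ^ 2) :
    Hi (x + y * Complex.I) =
      (1 / (Real.pi : ℂ)) * ∫ u in Ioi (0 : ℝ),
        Complex.exp (-((u ^ 3 / 3 - u * (V x y u) ^ 2 - x * u + y * V x y u : ℝ) : ℂ)) *
          (1 + Complex.I *
            (((2 * u * V x y u - y) / ((V x y u) ^ 2 - u ^ 2 + x) : ℝ) : ℂ)) := by
  have hVd := hasDerivAt_V x y hx hxy
  have hVc : Continuous (V x y) := continuous_iff_continuousAt.2 fun u => (hVd u).continuousAt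
  have hne : ∀ u, V x y u ^ 2 - u ^ 2 + x ≠ 0 := fun u => by
    have := V_sq_lt x y hx hxy u
    linarith
  have hbound : ∀ u, 3 * ((3 / 2 * y) ^ 2 + 1) ≤ u →
      1 ≤ u ∧ 0 ≤ V x y u ∧ V x y u ≤ 3 / 2 * y ∧ u * V x y u ≤ 3 / 2 * y := fun u hu => by
    have hu1 : 1 ≤ u := by nlinarith [sq_nonneg (3 / 2 * y)]
    have h0 := V_nonneg x y hx hy (u := u) (by linarith)
    have h1 := V_mul_le x y hx hy hxy (u := u) (by linarith)
    exact ⟨hu1, h0, by nlinarith, h1⟩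
  unfold Hi
  congr 1
  rw [integral_Ioi_eq_integral_path
    (g := fun w => Complex.exp ((x + y * Complex.I) * w - w ^ 3 / 3)) (by fun_prop) hVd
    (by simp [V]) (by fun_prop (disch := exact hne _)) (M := 3 / 2 * y) (D := 3 * y)
    (U := 3 * ((3 / 2 * y) ^ 2 + 1)) (fun u hu => ⟨(hbound u hu).2.1, (hbound u hu).2.2.1⟩) ?_
    (fun u s hu hs hsM => norm_exp_scorer_le x y _ hx hy hu hs hsM)]
  · refine integral_congr_ae (Eventually.of_forall fun u => ?_)
    dsimp only
    congr 2
    have hc : ((V x y u ^ 3 - 3 * (u ^ 2 - x) * V x y u + 3 * y * u : ℝ) : ℂ) = 0 := by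
      rw [V_cubic x y hx hxy u, Complex.ofReal_zero]
    push_cast at hc ⊢
    linear_combination (y * V x y u - u * (V x y u : ℂ) ^ 2
      - (V x y u : ℂ) ^ 3 * Complex.I / 3) * Complex.I_sq + Complex.I / 3 * hc
  · intro u hu
    obtain ⟨hu1, h0, h1, h2⟩ := hbound u hu
    have hden : 1 ≤ |V x y u ^ 2 - u ^ 2 + x| := by
      rw [le_abs]
      right
      nlinarith
    rw [abs_div]
    refine (div_le_self (abs_nonneg _) hden).trans (abs_le.2 ⟨?_, ?_⟩)
    · nlinarith
    · nlinarith
end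

section
/- For every real x ≥ 0 the Scorer function Gi admits the non-oscillating real integral representation Gi(x) = (1/π) · [ ∫₀^{√x} exp(−x v + v³/3) dv + ∫_{√x}^∞ exp(2 x v − (8/3) v³) dv ], where the first integral is over the bounded interval [0, √x] and the second is a Lebesgue integral over (√x, ∞). -/
open Filter MeasureTheory Set

/-- The analytic continuation of the phase factor `exp (i (x t + t ^ 3 / 3))` to complex `t`. -/
noncomputable def scorerKernel (x : ℝ) (z : ℂ) : ℂ :=
  Complex.exp (Complex.I * (x * z + z ^ 3 / 3))

lemma scorerKernel_add_mul_I (x u v : ℝ) :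
    scorerKernel x (u + v * Complex.I) =
      Complex.exp ((v ^ 3 / 3 - x * v - u ^ 2 * v : ℝ) +
        (u * (x + u ^ 2 / 3 - v ^ 2) : ℝ) * Complex.I) := by
  unfold scorerKernel
  congr 1
  push_cast
  linear_combination (-(v ^ 3 / 3 : ℂ) + x * v + u ^ 2 * v + u * v ^ 2 * Complex.I +
    v ^ 3 / 3 * Complex.I ^ 2) * Complex.I_sq

lemma exists_primitive_scorerKernel (x : ℝ) :
    ∃ G : ℂ → ℂ, ∀ z, HasDerivAt G (scorerKernel x z) z := by
  have h : Differentiable ℂ (scorerKernel x) := by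
    unfold scorerKernel
    fun_prop
  obtain ⟨G, hG⟩ := h.isExactOn_univ
  exact ⟨G, fun z => hG z (mem_univ z)⟩

lemma HasDerivAt.im_comp_curve {G : ℂ → ℂ} {γ : ℝ → ℂ} {G' γ' : ℂ} {t : ℝ}
    (hG : HasDerivAt G G' (γ t)) (hγ : HasDerivAt γ γ' t) :
    HasDerivAt (fun s => (G (γ s)).im) (γ' * G').im t :=
  Complex.imCLM.hasFDerivAt.comp_hasDerivAt t (hG.scomp t hγ)

/-- Along the real axis the primitive integrates the oscillating sine. -/
lemma integral_sin_eq_im_sub {x : ℝ} {G : ℂ → ℂ} (hG : ∀ z, HasDerivAt G (scorerKernel x z) z)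
    (R : ℝ) :
    ∫ t in (0 : ℝ)..R, Real.sin (x * t + t ^ 3 / 3) = (G R).im - (G 0).im := by
  have h : ∀ t : ℝ, HasDerivAt (fun s : ℝ => (G s).im) (Real.sin (x * t + t ^ 3 / 3)) t := by
    intro t
    convert (hG t).im_comp_curve (γ := fun s : ℝ => (s : ℂ)) Complex.ofRealCLM.hasDerivAt using 1
    have := scorerKernel_add_mul_I x t 0
    simp only [Complex.ofReal_zero, zero_mul, add_zero] at this
    rw [this, Complex.ofRealCLM_apply, Complex.ofReal_one, one_mul, Complex.exp_im]
    simp only [Complex.add_re, Complex.add_im, Complex.ofReal_re, Complex.ofReal_im,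
      Complex.re_ofReal_mul, Complex.im_ofReal_mul, Complex.I_re, Complex.I_im]
    norm_num
    ring_nf
  rw [intervalIntegral.integral_eq_sub_of_hasDerivAt (fun t _ => h t)
    (Continuous.intervalIntegrable (by fun_prop) _ _)]
  simp

/-- Along the imaginary axis the primitive integrates a real exponential. -/
lemma integral_exp_eq_im_sub {x : ℝ} {G : ℂ → ℂ} (hG : ∀ z, HasDerivAt G (scorerKernel x z) z)
    (a : ℝ) :
    ∫ v in (0 : ℝ)..a, Real.exp (-x * v + v ^ 3 / 3) = (G (a * Complex.I)).im - (G 0).im := by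
  have h : ∀ t : ℝ, HasDerivAt (fun s : ℝ => (G (s * Complex.I)).im)
      (Real.exp (-x * t + t ^ 3 / 3)) t := by
    intro t
    convert (hG (t * Complex.I)).im_comp_curve (γ := fun s : ℝ => (s * Complex.I : ℂ))
      (Complex.ofRealCLM.hasDerivAt.mul_const Complex.I) using 1
    have := scorerKernel_add_mul_I x 0 t
    simp only [Complex.ofReal_zero, zero_mul, add_zero, zero_add] at this
    rw [this, Complex.ofRealCLM_apply, Complex.ofReal_one, one_mul, ← Complex.ofReal_exp]
    simp only [Complex.mul_im, Complex.ofReal_re, Complex.ofReal_im, Complex.I_re, Complex.I_im]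
    ring_nf
  rw [intervalIntegral.integral_eq_sub_of_hasDerivAt (fun t _ => h t)
    (Continuous.intervalIntegrable (by fun_prop) _ _)]
  simp

/-- The real part of the point at height `v` on the steepest descent curve from `i √x`. -/
noncomputable def descentRe (x v : ℝ) : ℝ := Real.sqrt (3 * (v ^ 2 - x))

lemma tendsto_descentRe_atTop (x : ℝ) : Tendsto (descentRe x) atTop atTop := by
  refine Real.tendsto_sqrt_atTop.comp (Tendsto.const_mul_atTop (by norm_num) ?_)
  exact tendsto_atTop_add_const_right _ (-x) (tendsto_pow_atTop two_ne_zero)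

/-- On the steepest descent curve the kernel is real and positive. -/
lemma scorerKernel_descent {x v : ℝ} (h : x ≤ v ^ 2) :
    scorerKernel x (descentRe x v + v * Complex.I) =
      (Real.exp (2 * x * v - (8 / 3) * v ^ 3) : ℝ) := by
  have hs : descentRe x v ^ 2 = 3 * (v ^ 2 - x) := Real.sq_sqrt (by linarith)
  rw [scorerKernel_add_mul_I, hs, Complex.ofReal_exp]
  congr 1
  have : descentRe x v * (x + 3 * (v ^ 2 - x) / 3 - v ^ 2) = 0 := by ring
  rw [this, Complex.ofReal_zero, zero_mul, add_zero]
  congr 1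
  ring

lemma hasDerivAt_im_descent {x v : ℝ} {G : ℂ → ℂ}
    (hG : ∀ z, HasDerivAt G (scorerKernel x z) z) (h : x < v ^ 2) :
    HasDerivAt (fun s : ℝ => (G (descentRe x s + s * Complex.I)).im)
      (Real.exp (2 * x * v - (8 / 3) * v ^ 3)) v := by
  have hd : DifferentiableAt ℝ (descentRe x) v := by
    unfold descentRe
    exact DifferentiableAt.sqrt (by fun_prop) (by linarith)
  have hγ := hd.hasDerivAt.ofReal_comp.add (Complex.ofRealCLM.hasDerivAt.mul_const Complex.I)
  convert (hG (descentRe x v + v * Complex.I)).im_comp_curve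
    (γ := fun s : ℝ => (descentRe x s + s * Complex.I : ℂ)) hγ using 1
  rw [scorerKernel_descent h.le, Complex.im_mul_ofReal]
  simp

/-- The vertical segment joining the real axis to the steepest descent curve
contributes `O(R⁻²)`. -/
lemma norm_primitive_vertical_le {x v : ℝ} {G : ℂ → ℂ}
    (hG : ∀ z, HasDerivAt G (scorerKernel x z) z) (hx : 0 ≤ x) (hv : 0 ≤ v) (h : x < v ^ 2) :
    ‖G (descentRe x v + v * Complex.I) - G (descentRe x v)‖ ≤ 9 / (8 * descentRe x v ^ 2) := by
  have hs : descentRe x v ^ 2 = 3 * (v ^ 2 - x) := Real.sq_sqrt (by linarith)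
  have hpos : 0 < descentRe x v ^ 2 := by rw [hs]; linarith
  set u := descentRe x v
  set c := 8 / 9 * u ^ 2 with hc
  have hc0 : 0 < c := by positivity
  have hf : ∀ y : ℝ, HasDerivAt (fun s : ℝ => G (u + s * Complex.I) - G u)
      (Complex.I * scorerKernel x (u + y * Complex.I)) y := by
    intro y
    have hγ := (Complex.ofRealCLM.hasDerivAt (x := y)).mul_const Complex.I |>.const_add (u : ℂ)
    have := ((hG (u + y * Complex.I)).scomp y
      (h := fun s : ℝ => (u + s * Complex.I : ℂ)) hγ).sub_const (G u)
    simpa using this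
  have hB : ∀ y : ℝ, HasDerivAt (fun s : ℝ => (1 - Real.exp (-c * s)) / c)
      (Real.exp (-c * y)) y := by
    intro y
    have := ((((hasDerivAt_id y).const_mul (-c)).exp).const_sub 1).div_const c
    refine this.congr_deriv ?_
    simp only [id]
    field_simp
  have key := image_norm_le_of_norm_deriv_right_le_deriv_boundary (a := 0) (b := v)
    (fun y _ => (hf y).continuousAt.continuousWithinAt)
    (fun y _ => (hf y).hasDerivWithinAt) (by simp) hB (fun y hy => ?_) (right_mem_Icc.2 hv)
  · refine key.trans ?_
    calc (1 - Real.exp (-c * v)) / c ≤ 1 / c := by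
          gcongr
          linarith [Real.exp_pos (-c * v)]
      _ = 9 / (8 * u ^ 2) := by rw [hc]; field_simp
  · rw [norm_mul, Complex.norm_I, one_mul, scorerKernel_add_mul_I, Complex.norm_exp]
    simp only [Complex.add_re, Complex.ofReal_re, Complex.re_ofReal_mul, Complex.I_re, mul_zero,
      add_zero]
    rw [Real.exp_le_exp]
    have hy2 : y ^ 2 ≤ v ^ 2 := pow_le_pow_left₀ hy.1 hy.2.le 2
    have h1 : y * y ^ 2 ≤ y * v ^ 2 := mul_le_mul_of_nonneg_left hy2 hy.1
    have h2 : 0 ≤ x * y := mul_nonneg hx hy.1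
    rw [hc, hs]
    nlinarith

theorem scorer_Gi_nonoscillating_integral (Gi : ℝ → ℝ)
    (hGi : ∀ x : ℝ, Tendsto (fun R : ℝ => ∫ t in (0 : ℝ)..R, Real.sin (x * t + t ^ 3 / 3))
      atTop (nhds (Real.pi * Gi x))) :
    ∀ x : ℝ, 0 ≤ x →
      Gi x = (1 / Real.pi) *
        ((∫ v in (0 : ℝ)..Real.sqrt x, Real.exp (-x * v + v ^ 3 / 3)) +
          ∫ v in Ioi (Real.sqrt x), Real.exp (2 * x * v - (8 / 3) * v ^ 3)) := by
  intro x hx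
  obtain ⟨G, hG⟩ := exists_primitive_scorerKernel x
  have hGc : Continuous G := continuous_iff_continuousAt.2 fun z => (hG z).continuousAt
  have hlt : ∀ v ∈ Ioi (Real.sqrt x), x < v ^ 2 := fun v hv =>
    (Real.sqrt_lt' ((Real.sqrt_nonneg x).trans_lt hv)).1 hv
  have hR := tendsto_descentRe_atTop x
  have hreal : Tendsto (fun v => (G (descentRe x v)).im) atTop
      (nhds (Real.pi * Gi x + (G 0).im)) := by
    have := ((hGi x).comp hR).add_const (G 0).im
    simpa [Function.comp_def, integral_sin_eq_im_sub hG] using this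
  have hvert : Tendsto (fun v : ℝ => G (descentRe x v + v * Complex.I) - G (descentRe x v))
      atTop (nhds 0) := by
    have hlim : Tendsto (fun v => 9 / (8 * descentRe x v ^ 2)) atTop (nhds 0) :=
      tendsto_const_nhds.div_atTop
        (((tendsto_pow_atTop two_ne_zero).comp hR).const_mul_atTop (by norm_num))
    refine squeeze_zero_norm' ?_ hlim
    filter_upwards [Ioi_mem_atTop (Real.sqrt x)] with v hv
    exact norm_primitive_vertical_le hG hx ((Real.sqrt_nonneg x).trans (le_of_lt hv)) (hlt v hv)
  have hcurve : Tendsto (fun v : ℝ => (G (descentRe x v + v * Complex.I)).im) atTop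
      (nhds (Real.pi * Gi x + (G 0).im)) := by
    have := ((Complex.continuous_im.tendsto 0).comp hvert).add hreal
    simpa [Function.comp_def] using this
  have hcont : Continuous fun v : ℝ => (G (descentRe x v + v * Complex.I)).im := by
    unfold descentRe
    fun_prop
  have hend : descentRe x (Real.sqrt x) = 0 := by
    simp [descentRe, Real.sq_sqrt hx]
  rw [integral_Ioi_of_hasDerivAt_of_nonneg hcont.continuousWithinAt
    (fun v hv => hasDerivAt_im_descent hG (hlt v hv)) (fun v _ => (Real.exp_pos _).le) hcurve,
    integral_exp_eq_im_sub hG, hend]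
  have := Real.pi_ne_zero
  simp only [Complex.ofReal_zero, zero_add]
  field_simp
  ring
end

section
/- The Scorer function Gi satisfies Gi(x) ∼ 1/(π x) as x → +∞ along the real axis; precisely, lim_{x→+∞} π · x · Gi(x) = 1. -/
open Filter

/-- Two integrations by parts: a primitive of `sin (x t + t³ / 3)` up to an absolutely integrable
remainder. -/
theorem hasDerivAt_scorer_primitive {x : ℝ} (hx : 0 < x) (t : ℝ) :
    HasDerivAt (fun t : ℝ => -Real.cos (x * t + t ^ 3 / 3) / (x + t ^ 2)
        - Real.sin (x * t + t ^ 3 / 3) * (2 * t / (x + t ^ 2) ^ 3))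
      (Real.sin (x * t + t ^ 3 / 3) - Real.sin (x * t + t ^ 3 / 3) *
        (2 / (x + t ^ 2) ^ 3 - 12 * t ^ 2 / (x + t ^ 2) ^ 4)) t := by
  have hp : x + t ^ 2 ≠ 0 := by positivity
  have hphase : HasDerivAt (fun t : ℝ => x * t + t ^ 3 / 3) (x + t ^ 2) t := by
    refine (((hasDerivAt_id' t).const_mul x).add ((hasDerivAt_pow 3 t).div_const 3)).congr_deriv ?_
    norm_num
  have hden : HasDerivAt (fun t : ℝ => x + t ^ 2) (2 * t) t := by
    simpa using (hasDerivAt_pow 2 t).const_add x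
  have hnum : HasDerivAt (fun t : ℝ => 2 * t) 2 t := by
    simpa using (hasDerivAt_id t).const_mul 2
  refine ((hphase.cos.neg.div hden hp).sub
    (hphase.sin.mul (hnum.div (hden.pow 3) (pow_ne_zero 3 hp)))).congr_deriv ?_
  simp only [Pi.neg_apply, Pi.div_apply, Pi.pow_apply]
  field_simp
  ring

theorem abs_scorer_remainder_le {x : ℝ} (hx : 1 ≤ x) (t : ℝ) :
    |2 / (x + t ^ 2) ^ 3 - 12 * t ^ 2 / (x + t ^ 2) ^ 4| ≤ 14 / x ^ 2 * (1 + t ^ 2)⁻¹ := by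
  have hx0 : 0 < x := by linarith
  have ht : 0 ≤ t ^ 2 := sq_nonneg t
  have hp : 0 < x + t ^ 2 := by positivity
  have hsplit : |2 / (x + t ^ 2) ^ 3 - 12 * t ^ 2 / (x + t ^ 2) ^ 4| ≤ 14 / (x + t ^ 2) ^ 3 := by
    have h : 12 * t ^ 2 / (x + t ^ 2) ^ 4 ≤ 12 / (x + t ^ 2) ^ 3 := by
      rw [div_le_div_iff₀ (by positivity) (by positivity)]
      nlinarith [mul_nonneg hx0.le (pow_pos hp 3).le]
    have h0 : 0 ≤ 12 * t ^ 2 / (x + t ^ 2) ^ 4 := by positivity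
    have h1 : 0 ≤ 2 / (x + t ^ 2) ^ 3 := by positivity
    have h2 : 14 / (x + t ^ 2) ^ 3 = 2 / (x + t ^ 2) ^ 3 + 12 / (x + t ^ 2) ^ 3 := by ring
    rw [abs_le]
    constructor <;> linarith
  refine hsplit.trans ?_
  rw [← div_eq_mul_inv, div_div]
  have : x ^ 2 * (1 + t ^ 2) ≤ (x + t ^ 2) ^ 2 * (x + t ^ 2) := by
    gcongr
    linarith
  gcongr
  linarith

theorem abs_scorer_boundary_le {x R : ℝ} (hx : 1 ≤ x) (hR : 1 ≤ R) :
    |-Real.cos (x * R + R ^ 3 / 3) / (x + R ^ 2)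
        - Real.sin (x * R + R ^ 3 / 3) * (2 * R / (x + R ^ 2) ^ 3)| ≤ 3 / R := by
  have hR0 : 0 < R := by linarith
  have hp : R ≤ x + R ^ 2 := by nlinarith
  have hp1 : 1 ≤ x + R ^ 2 := hR.trans hp
  have h1 : |-Real.cos (x * R + R ^ 3 / 3) / (x + R ^ 2)| ≤ 1 / R := by
    rw [abs_div, abs_neg, abs_of_pos (show 0 < x + R ^ 2 by linarith)]
    gcongr
    exact Real.abs_cos_le_one _
  have h2 : |Real.sin (x * R + R ^ 3 / 3) * (2 * R / (x + R ^ 2) ^ 3)| ≤ 2 / R := by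
    rw [abs_mul, abs_of_nonneg (show 0 ≤ 2 * R / (x + R ^ 2) ^ 3 by positivity)]
    refine (mul_le_of_le_one_left (by positivity) (Real.abs_sin_le_one _)).trans ?_
    rw [div_le_div_iff₀ (by positivity) hR0]
    have h3 : R ^ 2 ≤ (x + R ^ 2) ^ 2 := by gcongr
    have h4 : (x + R ^ 2) ^ 2 ≤ (x + R ^ 2) ^ 3 := pow_le_pow_right₀ hp1 (by norm_num)
    nlinarith
  calc _ ≤ _ := abs_sub _ _
    _ ≤ 1 / R + 2 / R := add_le_add h1 h2
    _ = 3 / R := by ring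

theorem abs_integral_scorer_sub_le {x R : ℝ} (hx : 1 ≤ x) (hR : 1 ≤ R) :
    |(∫ t in (0 : ℝ)..R, Real.sin (x * t + t ^ 3 / 3)) - 1 / x| ≤ 28 / x ^ 2 + 3 / R := by
  have hx0 : 0 < x := by linarith
  have hp (t : ℝ) : x + t ^ 2 ≠ 0 := by positivity
  have hsin : Continuous fun t : ℝ => Real.sin (x * t + t ^ 3 / 3) := by fun_prop
  have hrem : Continuous fun t : ℝ => Real.sin (x * t + t ^ 3 / 3) *
      (2 / (x + t ^ 2) ^ 3 - 12 * t ^ 2 / (x + t ^ 2) ^ 4) := by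
    refine hsin.mul ((continuous_const.div (by fun_prop) fun t => pow_ne_zero 3 (hp t)).sub
      (Continuous.div (by fun_prop) (by fun_prop) fun t => pow_ne_zero 4 (hp t)))
  have hftc := intervalIntegral.integral_eq_sub_of_hasDerivAt
    (fun t _ => hasDerivAt_scorer_primitive hx0 t)
    ((hsin.sub hrem).intervalIntegrable 0 R)
  rw [intervalIntegral.integral_sub (hsin.intervalIntegrable _ _)
    (hrem.intervalIntegrable _ _)] at hftc
  have hbound : |∫ t in (0 : ℝ)..R, Real.sin (x * t + t ^ 3 / 3) *
      (2 / (x + t ^ 2) ^ 3 - 12 * t ^ 2 / (x + t ^ 2) ^ 4)| ≤ 28 / x ^ 2 := by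
    have hcont : Continuous fun t : ℝ => 14 / x ^ 2 * (1 + t ^ 2)⁻¹ :=
      continuous_const.mul (Continuous.inv₀ (by fun_prop) fun t => by positivity)
    have h := intervalIntegral.norm_integral_le_of_norm_le (μ := MeasureTheory.volume)
      (f := fun t : ℝ => Real.sin (x * t + t ^ 3 / 3) *
        (2 / (x + t ^ 2) ^ 3 - 12 * t ^ 2 / (x + t ^ 2) ^ 4))
      (show (0 : ℝ) ≤ R by linarith)
      (MeasureTheory.ae_of_all _ fun t _ => by
        rw [Real.norm_eq_abs, abs_mul]
        exact (mul_le_of_le_one_left (abs_nonneg _) (Real.abs_sin_le_one _)).trans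
          (abs_scorer_remainder_le hx t))
      (hcont.intervalIntegrable 0 R)
    rw [intervalIntegral.integral_const_mul, integral_inv_one_add_sq, Real.arctan_zero,
      sub_zero, Real.norm_eq_abs] at h
    calc _ ≤ _ := h
      _ ≤ 14 / x ^ 2 * 2 := by
        gcongr
        linarith [Real.arctan_lt_pi_div_two R, Real.pi_le_four]
      _ = 28 / x ^ 2 := by ring
  have hR' := abs_scorer_boundary_le hx hR
  simp only [mul_zero, ne_eq, OfNat.ofNat_ne_zero, not_false_eq_true, zero_pow, zero_div,
    add_zero, Real.cos_zero, Real.sin_zero, sub_zero, neg_div] at hftc hR'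
  rw [abs_le] at hbound hR' ⊢
  constructor <;> linarith [hbound.1, hbound.2, hR'.1, hR'.2]

theorem scorer_Gi_asymptotic (Gi : ℝ → ℝ)
    (hGi : ∀ x : ℝ, Tendsto (fun R : ℝ => ∫ t in (0 : ℝ)..R, Real.sin (x * t + t ^ 3 / 3))
      atTop (nhds (Real.pi * Gi x))) :
    Tendsto (fun x : ℝ => Real.pi * x * Gi x) atTop (nhds 1) := by
  have hbound (x : ℝ) (hx : 1 ≤ x) : |Real.pi * Gi x - 1 / x| ≤ 28 / x ^ 2 := by
    have hlim : Tendsto (fun R : ℝ => 28 / x ^ 2 + 3 / R) atTop (nhds (28 / x ^ 2)) := by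
      have h := ((tendsto_id (α := ℝ)).const_div_atTop 3).const_add (28 / x ^ 2)
      rwa [add_zero] at h
    refine le_of_tendsto_of_tendsto ((hGi x).sub_const (1 / x)).abs hlim ?_
    filter_upwards [eventually_ge_atTop 1] with R hR
    exact abs_integral_scorer_sub_le hx hR
  rw [tendsto_iff_norm_sub_tendsto_zero]
  refine squeeze_zero' (Eventually.of_forall fun x => norm_nonneg _) ?_
    ((tendsto_id (α := ℝ)).const_div_atTop 28)
  filter_upwards [eventually_ge_atTop 1] with x hx
  have hx0 : 0 < x := by linarith
  have h : Real.pi * x * Gi x - 1 = x * (Real.pi * Gi x - 1 / x) := by field_simp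
  rw [h, norm_mul, Real.norm_eq_abs, Real.norm_eq_abs, abs_of_pos hx0]
  calc x * |Real.pi * Gi x - 1 / x| ≤ x * (28 / x ^ 2) := by gcongr; exact hbound x hx
    _ = 28 / x := by field_simp
end

section
/- The Scorer function Hi satisfies Hi(−x) ∼ 1/(π x) as x → +∞ along the real axis; precisely, lim_{x→+∞} π · x · Hi(−x) = 1, where Hi(−x) = (1/π) ∫₀^∞ exp(−x t − t³/3) dt. -/
open Filter MeasureTheory Set

/-- Rescaling `t = u / x` in the integral that defines `Hi (-x)`. -/
theorem pi_mul_mul_Hi_neg {x : ℝ} (hx : 0 < x) :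
    (Real.pi : ℂ) * (x : ℂ) * Hi (-(x : ℂ)) =
      ∫ u in Ioi (0 : ℝ), Complex.exp (-(u : ℂ) - ((x⁻¹ * u : ℝ) : ℂ) ^ 3 / 3) := by
  have hpi : (Real.pi : ℂ) ≠ 0 := by exact_mod_cast Real.pi_ne_zero
  have hx0 : (x : ℂ) ≠ 0 := by exact_mod_cast hx.ne'
  have h := integral_comp_mul_left_Ioi
    (fun t : ℝ => Complex.exp (-(x : ℂ) * t - (t : ℂ) ^ 3 / 3)) 0 (inv_pos.mpr hx)
  rw [mul_zero, inv_inv, Complex.real_smul] at h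
  have h' : (Real.pi : ℂ) * (x : ℂ) * Hi (-(x : ℂ)) =
      x * ∫ t in Ioi (0 : ℝ), Complex.exp (-(x : ℂ) * t - (t : ℂ) ^ 3 / 3) := by
    rw [Hi]
    field_simp
  rw [h', ← h]
  congr 1 with u
  congr 2
  push_cast
  field_simp

theorem scorer_Hi_asymptotic_neg_axis :
    Tendsto (fun x : ℝ => (Real.pi : ℂ) * (x : ℂ) * Hi (-(x : ℂ))) atTop (nhds 1) := by
  have hlim : ∫ u in Ioi (0 : ℝ), Complex.exp (-(u : ℂ)) = 1 := by
    have h := congrArg (Complex.ofReal) integral_exp_neg_Ioi_zero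
    rw [← integral_complex_ofReal] at h
    simpa using h
  rw [← hlim]
  refine Tendsto.congr' ((eventually_gt_atTop 0).mono fun x hx => (pi_mul_mul_Hi_neg hx).symm) ?_
  refine tendsto_integral_filter_of_dominated_convergence (fun u => Real.exp (-u)) ?_ ?_
    (integrableOn_exp_neg_Ioi 0) ?_
  · exact Eventually.of_forall fun x => Continuous.aestronglyMeasurable (by fun_prop)
  · filter_upwards [eventually_gt_atTop 0] with x hx
    filter_upwards [ae_restrict_mem measurableSet_Ioi] with u hu
    have hu' : 0 < u := hu
    have hre : -(u : ℂ) - ((x⁻¹ * u : ℝ) : ℂ) ^ 3 / 3 =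
        ((-u - (x⁻¹ * u) ^ 3 / 3 : ℝ) : ℂ) := by push_cast; rfl
    rw [hre, Complex.norm_exp, Complex.ofReal_re, Real.exp_le_exp]
    have : 0 ≤ (x⁻¹ * u) ^ 3 / 3 := by positivity
    linarith
  · refine Eventually.of_forall fun u => ?_
    have h : Tendsto (fun x : ℝ => x⁻¹ * u) atTop (nhds 0) := by
      simpa using tendsto_inv_atTop_zero.mul_const u
    have hc : Continuous fun s : ℝ => Complex.exp (-(u : ℂ) - (s : ℂ) ^ 3 / 3) := by fun_prop
    simpa [Function.comp_def] using (hc.tendsto 0).comp h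
end
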